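/- arXiv:2008.09189 — 12 statements merged into one kernel-verified Lean document; each statement's English description precedes it below -/
import Mathlib

section
/- Let k ≥ 4. In the quotient ring A = ℂ[x_1,…,x_{2k}]/⟨Q⟩, all exchange relations of the type A_1^{k-2} cluster structure hold: (i) x_i·x_{2k+1-i} = p_{i-1} + p_{i-2} for every i with 3 ≤ i ≤ k−2; (ii) x_2·x_{2k-1} = p_1 + x_1·x_{2k}; and (iii) x_{k-1}·x_{k+2} = x_k·x_{k+1} + p_{k-3}. -/
open MvPolynomial

/-- The quadratic form `Q(x_1,…,x_{2k}) = Σ_{i=1}^{k} (−1)^{i−1} x_i x_{2k+1−i}`,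
as an element of `ℂ[x_1,…,x_{2k}]` (variables indexed `1,…,2k`). -/
noncomputable def quadQ (k : ℕ) : MvPolynomial ℕ ℂ :=
  ∑ i ∈ Finset.Icc 1 k, (-1 : MvPolynomial ℕ ℂ) ^ (i - 1) * X i * X (2 * k + 1 - i)

/-- `p_s = Σ_{i=1}^{s+1} (−1)^{s+1−i} x_i x_{2k+1−i}`. -/
noncomputable def pQ (k s : ℕ) : MvPolynomial ℕ ℂ :=
  ∑ i ∈ Finset.Icc 1 (s + 1), (-1 : MvPolynomial ℕ ℂ) ^ (s + 1 - i) * X i * X (2 * k + 1 - i)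

/-- Consecutive `p_s` sum to a single monomial. -/
theorem pQ_succ_add (k s : ℕ) :
    pQ k (s + 1) + pQ k s = X (s + 2) * X (2 * k + 1 - (s + 2)) := by
  have h : ∑ i ∈ Finset.Icc 1 (s + 1),
      (-1 : MvPolynomial ℕ ℂ) ^ (s + 1 + 1 - i) * X i * X (2 * k + 1 - i) = -pQ k s := by
    rw [pQ, ← Finset.sum_neg_distrib]
    refine Finset.sum_congr rfl fun i hi => ?_
    rw [Nat.succ_sub (Finset.mem_Icc.mp hi).2, pow_succ]
    ring
  rw [pQ, Finset.sum_Icc_succ_top (by omega), h, Nat.sub_self]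
  ring

theorem pQ_zero (k : ℕ) : pQ k 0 = X 1 * X (2 * k) := by
  simp [pQ]

/-- Up to sign, `Q` is the last of the `p_s`. -/
theorem pQ_eq_neg_one_pow_mul_quadQ (n : ℕ) :
    pQ (n + 1) n = (-1) ^ n * quadQ (n + 1) := by
  rw [pQ, quadQ, Finset.mul_sum]
  refine Finset.sum_congr rfl fun i hi => ?_
  obtain ⟨h1, h2⟩ := Finset.mem_Icc.mp hi
  have h : (-1 : MvPolynomial ℕ ℂ) ^ n * (-1) ^ (i - 1) = (-1) ^ (n + 1 - i) := by
    rw [show n = (n + 1 - i) + (i - 1) by omega, pow_add, mul_assoc, ← mul_pow]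
    simp [show n + 1 - i + (i - 1) + 1 - i = n + 1 - i by omega]
  rw [← h]
  ring

/-- In the quotient ring `A = ℂ[x_1,…,x_{2k}]/⟨Q⟩` (for `k ≥ 4`), the exchange relations
of the type `A_1^{k-2}` cluster structure hold. -/
theorem quadric_exchange_relations (k : ℕ) (hk : 4 ≤ k) :
    (∀ i : ℕ, 3 ≤ i → i ≤ k - 2 →
      Ideal.Quotient.mk (Ideal.span {quadQ k}) (X i * X (2 * k + 1 - i)) =
        Ideal.Quotient.mk (Ideal.span {quadQ k}) (pQ k (i - 1) + pQ k (i - 2))) ∧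
    (Ideal.Quotient.mk (Ideal.span {quadQ k}) (X 2 * X (2 * k - 1)) =
        Ideal.Quotient.mk (Ideal.span {quadQ k}) (pQ k 1 + X 1 * X (2 * k))) ∧
    (Ideal.Quotient.mk (Ideal.span {quadQ k}) (X (k - 1) * X (k + 2)) =
        Ideal.Quotient.mk (Ideal.span {quadQ k}) (X k * X (k + 1) + pQ k (k - 3))) := by
  refine ⟨fun i hi _ => ?_, ?_, ?_⟩
  · obtain ⟨s, rfl⟩ : ∃ s, i = s + 2 := ⟨i - 2, by omega⟩
    exact congrArg _ (pQ_succ_add k s).symm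
  · rw [← pQ_zero, pQ_succ_add]
    rfl
  · obtain ⟨m, rfl⟩ : ∃ m, k = m + 3 := ⟨k - 3, by omega⟩
    have h1 := pQ_succ_add (m + 3) (m + 1)
    have h2 := pQ_succ_add (m + 3) m
    rw [show 2 * (m + 3) + 1 - (m + 1 + 2) = m + 3 + 1 by omega] at h1
    rw [show 2 * (m + 3) + 1 - (m + 2) = m + 3 + 2 by omega] at h2
    have h3 : pQ (m + 3) (m + 2) = (-1) ^ (m + 2) * quadQ (m + 3) :=
      pQ_eq_neg_one_pow_mul_quadQ (m + 2)
    rw [eq_comm, Ideal.Quotient.eq, Ideal.mem_span_singleton]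
    refine ⟨(-1) ^ (m + 2), ?_⟩
    rw [show m + 3 - 1 = m + 2 by omega, Nat.add_sub_cancel]
    linear_combination h2 - h1 + h3
end

section
/- Let 2 ≤ a ≤ b. Let A_{a,b} be the ℂ-subalgebra of the polynomial ring in the entries of a generic a×b matrix generated by all maximal (a×a) minors P_J, where J ranges over a-element subsets of the column set {1,…,b}; similarly let A_{a−1,b−1} be the ℂ-subalgebra generated by the maximal minors of a generic (a−1)×(b−1) matrix. Then there exists an injective ℂ-algebra homomorphism φ : A_{a−1,b−1} → A_{a,b} such that φ(P_I) = P_{I∪{b}} for every (a−1)-element subset I of {1,…,b−1}. -/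
open MvPolynomial

/-- The Plücker coordinate `P_J` of a generic matrix of indeterminates (rows indexed
`1, 2, …, a`, columns indexed by natural numbers): the `a×a` minor occupying the
columns in the `a`-element set `J`, taken in increasing order. -/
noncomputable def plucker (a : ℕ) (J : Finset ℕ) (h : J.card = a) :
    MvPolynomial (ℕ × ℕ) ℂ :=
  Matrix.det (Matrix.of fun r c : Fin a => X ((r : ℕ) + 1, J.orderEmbOfFin h c))

/-- The set of maximal minors (Plücker coordinates) of a generic `a × b` matrix of
indeterminates, with column set `{1,…,b}`. -/
def pluckerSet (a b : ℕ) : Set (MvPolynomial (ℕ × ℕ) ℂ) :=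
  { p | ∃ (J : Finset ℕ) (h : J.card = a), J ⊆ Finset.Icc 1 b ∧ p = plucker a J h }

/-- Schur complement formula for the bottom-right entry of a square matrix. -/
theorem Matrix.det_eq_mul_det_sub_of_last {R : Type*} [CommRing R] {k : ℕ}
    (M : Matrix (Fin (k + 1)) (Fin (k + 1)) R) (v : R)
    (hv : M (Fin.last k) (Fin.last k) * v = 1) :
    M.det = M (Fin.last k) (Fin.last k) * Matrix.det (Matrix.of fun i j : Fin k =>
      M i.castSucc j.castSucc - M i.castSucc (Fin.last k) * v * M (Fin.last k) j.castSucc) := by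
  let e : Fin k ⊕ Fin 1 ≃ Fin (k + 1) := finSumFinEquiv
  let N := M.submatrix e e
  have hl : ∀ i, e (Sum.inl i) = i.castSucc := fun i => rfl
  have hr : ∀ i, e (Sum.inr i) = Fin.last k := fun i => by
    ext; simp [e, Subsingleton.elim i 0]
  let E : Matrix (Fin 1) (Fin 1) R := Matrix.of fun _ _ => v
  have hD : N.toBlocks₂₂ * E = 1 := by
    ext i j
    obtain rfl := Subsingleton.elim i j
    simp [Matrix.mul_apply, N, E, Matrix.toBlocks₂₂, hr, hv]
  let _ : Invertible N.toBlocks₂₂ := ⟨E, mul_eq_one_comm.mp hD, hD⟩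
  have hinv : ⅟N.toBlocks₂₂ = E := rfl
  rw [← Matrix.det_submatrix_equiv_self e M, ← Matrix.fromBlocks_toBlocks (M.submatrix e e)]
  rw [Matrix.det_fromBlocks₂₂, hinv]
  congr 1
  · simp [Matrix.toBlocks₂₂, hr]
  · congr 1
    ext i j
    simp [Matrix.mul_apply, Matrix.toBlocks₁₁, Matrix.toBlocks₁₂, Matrix.toBlocks₂₁, E, hl, hr]

theorem Finset.orderEmbOfFin_insert_of_forall_lt {k b : ℕ} {I : Finset ℕ} (hI : I.card = k)
    (hb : ∀ x ∈ I, x < b) (h : (insert b I).card = k + 1) :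
    ((insert b I).orderEmbOfFin h : Fin (k + 1) → ℕ) =
      Fin.snoc (α := fun _ => ℕ) (I.orderEmbOfFin hI) b := by
  symm
  apply Finset.orderEmbOfFin_unique
  · intro x
    refine Fin.lastCases ?_ (fun i => ?_) x
    · simp
    · simp
  · intro x y
    refine Fin.lastCases ?_ (fun j => ?_) y
    · refine Fin.lastCases ?_ (fun i => ?_) x
      · simp
      · intro _
        simpa using hb _ (I.orderEmbOfFin_mem hI i)
    · refine Fin.lastCases ?_ (fun i => ?_) x
      · intro hlt
        exact absurd hlt (not_lt.mpr (Fin.le_last _))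
      · simp

/-- An algebra homomorphism sends `P_{I ∪ {b}}`, for `b` larger than all elements of `I`, to a
Schur complement determinant as soon as the image of the corner variable has an inverse. -/
theorem map_plucker_insert {S : Type*} [CommRing S] [Algebra ℂ S] {k b : ℕ} {I : Finset ℕ}
    (f : MvPolynomial (ℕ × ℕ) ℂ →ₐ[ℂ] S) (v : S) (hv : f (X (k + 1, b)) * v = 1)
    (hI : I.card = k) (hb : ∀ x ∈ I, x < b) (h : (insert b I).card = k + 1) :
    f (plucker (k + 1) (insert b I) h) = f (X (k + 1, b)) * Matrix.det (Matrix.of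
      fun i j : Fin k => f (X ((i : ℕ) + 1, I.orderEmbOfFin hI j)) -
        f (X ((i : ℕ) + 1, b)) * v * f (X (k + 1, I.orderEmbOfFin hI j))) := by
  rw [plucker, AlgHom.map_det, Matrix.det_eq_mul_det_sub_of_last _ v]
  · simp [Finset.orderEmbOfFin_insert_of_forall_lt hI hb h]
  · simpa [Finset.orderEmbOfFin_insert_of_forall_lt hI hb h] using hv

/-- Specializing the last column to the last basis vector. -/
noncomputable def lastColumnSpecialization (k b : ℕ) :
    MvPolynomial (ℕ × ℕ) ℂ →ₐ[ℂ] MvPolynomial (ℕ × ℕ) ℂ :=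
  aeval fun p => if p.2 = b then (if p.1 = k + 1 then 1 else 0) else X p

theorem lastColumnSpecialization_plucker_insert {k b : ℕ} {I : Finset ℕ}
    (hI : I.card = k) (hb : ∀ x ∈ I, x < b) (h : (insert b I).card = k + 1) :
    lastColumnSpecialization k b (plucker (k + 1) (insert b I) h) = plucker k I hI := by
  rw [map_plucker_insert _ 1 (by simp [lastColumnSpecialization]) hI hb h, plucker]
  have hne : ∀ j, I.orderEmbOfFin hI j ≠ b := fun j => (hb _ (I.orderEmbOfFin_mem hI j)).ne
  have hlt : ∀ i : Fin k, (i : ℕ) ≠ k := fun i => i.isLt.ne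
  simp [lastColumnSpecialization, hne, hlt]

/-- Clearing column `b` with the help of row `k + 1`, and scaling the first row by the pivot. -/
noncomputable def columnClearing (k b : ℕ) :
    MvPolynomial (ℕ × ℕ) ℂ →ₐ[ℂ] FractionRing (MvPolynomial (ℕ × ℕ) ℂ) :=
  let ι := IsScalarTower.toAlgHom ℂ (MvPolynomial (ℕ × ℕ) ℂ)
    (FractionRing (MvPolynomial (ℕ × ℕ) ℂ))
  aeval fun p => (if p.1 = 1 then ι (X (k + 1, b)) else 1) *
    (ι (X p) - ι (X (p.1, b)) * (ι (X (k + 1, b)))⁻¹ * ι (X (k + 1, p.2)))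

theorem columnClearing_plucker {k b : ℕ} {I : Finset ℕ} (hk : 0 < k)
    (hI : I.card = k) (hb : ∀ x ∈ I, x < b) (h : (insert b I).card = k + 1) :
    columnClearing k b (plucker k I hI) =
      algebraMap _ (FractionRing (MvPolynomial (ℕ × ℕ) ℂ)) (plucker (k + 1) (insert b I) h) := by
  obtain ⟨n, rfl⟩ : ∃ n, k = n + 1 := ⟨k - 1, by omega⟩
  let ι := IsScalarTower.toAlgHom ℂ (MvPolynomial (ℕ × ℕ) ℂ)
    (FractionRing (MvPolynomial (ℕ × ℕ) ℂ))
  have hw : ι (X (n + 1 + 1, b)) ≠ 0 := by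
    intro h0
    exact X_ne_zero _ ((map_eq_zero_iff ι (IsFractionRing.injective _ _)).mp h0)
  change _ = ι _
  rw [map_plucker_insert ι _ (mul_inv_cancel₀ hw) hI hb h, plucker, AlgHom.map_det]
  have hprod : ∏ i : Fin (n + 1), (if i = 0 then ι (X (n + 1 + 1, b)) else 1) =
      ι (X (n + 1 + 1, b)) := by simp
  rw [← hprod, ← Matrix.det_mul_column, hprod]
  congr 1
  ext i j
  rw [AlgHom.mapMatrix_apply, Matrix.map_apply, Matrix.of_apply, columnClearing, aeval_X]
  simp only [Nat.add_eq_right, Fin.ext_iff, Fin.val_zero, Matrix.of_apply, ι]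

/-- Muir's-law embedding of Plücker rings: for `2 ≤ a ≤ b` there is an injective
`ℂ`-algebra homomorphism `A_{a−1,b−1} → A_{a,b}` sending `P_I` to `P_{I∪{b}}`. -/
theorem muir_embedding (a b : ℕ) (ha : 2 ≤ a) (hab : a ≤ b) :
    ∃ φ : Algebra.adjoin ℂ (pluckerSet (a - 1) (b - 1)) →ₐ[ℂ]
          Algebra.adjoin ℂ (pluckerSet a b),
      Function.Injective φ ∧
      ∀ (I : Finset ℕ) (h1 : I.card = a - 1) (h2 : I ⊆ Finset.Icc 1 (b - 1))
        (h3 : (insert b I).card = a),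
        φ ⟨plucker (a - 1) I h1, Algebra.subset_adjoin ⟨I, h1, h2, rfl⟩⟩ =
          ⟨plucker a (insert b I) h3, Algebra.subset_adjoin ⟨insert b I, h3, by
            intro x hx
            rcases Finset.mem_insert.mp hx with h | h
            · rw [h]
              exact Finset.mem_Icc.mpr ⟨by omega, le_refl b⟩
            · have := Finset.mem_Icc.mp (h2 h)
              exact Finset.mem_Icc.mpr ⟨this.1, by omega⟩, rfl⟩⟩ := by
  obtain ⟨k, rfl⟩ : ∃ k, a = k + 1 := ⟨a - 1, by omega⟩
  simp only [Nat.add_sub_cancel]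
  have hlt : ∀ I : Finset ℕ, I ⊆ Finset.Icc 1 (b - 1) → ∀ x ∈ I, x < b := by
    intro I hI x hx
    have := Finset.mem_Icc.mp (hI hx)
    omega
  have hcard : ∀ I : Finset ℕ, I ⊆ Finset.Icc 1 (b - 1) → I.card = k →
      (insert b I).card = k + 1 := by
    intro I hI hc
    rw [Finset.card_insert_of_notMem fun hmem => (hlt I hI b hmem).false, hc]
  have hsub : ∀ I : Finset ℕ, I ⊆ Finset.Icc 1 (b - 1) → insert b I ⊆ Finset.Icc 1 b := by
    intro I hI
    refine Finset.insert_subset (Finset.mem_Icc.mpr ⟨by omega, le_rfl⟩)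
      (hI.trans (Finset.Icc_subset_Icc_right (by omega)))
  let A := Algebra.adjoin ℂ (pluckerSet k (b - 1))
  let B := Algebra.adjoin ℂ (pluckerSet (k + 1) b)
  let ι := (IsScalarTower.toAlgHom ℂ (MvPolynomial (ℕ × ℕ) ℂ)
    (FractionRing (MvPolynomial (ℕ × ℕ) ℂ))).comp B.val
  have hι : Function.Injective ι :=
    (IsFractionRing.injective (MvPolynomial (ℕ × ℕ) ℂ) _).comp Subtype.val_injective
  have hrange : ∀ x : A, (columnClearing k b).comp A.val x ∈ ι.range := by
    have hle : A ≤ ι.range.comap (columnClearing k b) := by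
      refine Algebra.adjoin_le ?_
      rintro _ ⟨I, hI, hIb, rfl⟩
      exact ⟨⟨_, Algebra.subset_adjoin ⟨_, hcard I hIb hI, hsub I hIb, rfl⟩⟩,
        (columnClearing_plucker (by omega) hI (hlt I hIb) _).symm⟩
    exact fun x => hle x.2
  let φ : A →ₐ[ℂ] B := (AlgEquiv.ofInjective ι hι).symm.toAlgHom.comp
    (((columnClearing k b).comp A.val).codRestrict ι.range hrange)
  have hφ : ∀ x : A, ι (φ x) = columnClearing k b x := fun x =>
    congrArg Subtype.val ((AlgEquiv.ofInjective ι hι).apply_symm_apply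
      ⟨columnClearing k b x, hrange x⟩)
  have hgen : ∀ (I : Finset ℕ) (h1 : I.card = k) (h2 : I ⊆ Finset.Icc 1 (b - 1))
      (h3 : (insert b I).card = k + 1),
      φ ⟨plucker k I h1, Algebra.subset_adjoin ⟨I, h1, h2, rfl⟩⟩ =
        ⟨plucker (k + 1) (insert b I) h3,
          Algebra.subset_adjoin ⟨insert b I, h3, hsub I h2, rfl⟩⟩ := by
    intro I h1 h2 h3
    apply hι
    rw [hφ]
    exact columnClearing_plucker (by omega) h1 (hlt I h2) h3
  have hleft : ((lastColumnSpecialization k b).comp B.val).comp φ = A.val := by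
    refine AlgHom.adjoin_ext ?_
    rintro _ ⟨I, h1, h2, rfl⟩
    have h3 := hcard I h2 h1
    simp only [AlgHom.comp_apply]
    rw [hgen I h1 h2 h3]
    exact lastColumnSpecialization_plucker_insert h1 (hlt I h2) h3
  refine ⟨φ, fun x y hxy => Subtype.val_injective ?_, hgen⟩
  have := congrArg ((lastColumnSpecialization k b).comp B.val) hxy
  rwa [← AlgHom.comp_apply, ← AlgHom.comp_apply, hleft] at this
end

section
/- Let 1 ≤ a < b < c < d < e ≤ m. Then in the polynomial ring ℂ[z_{rc}] the identity P_{a c̄}·P_{bd} = P_{a b̄}·P_{cd} + P_{a d̄}·P_{bc} holds, where P_{x ȳ} := P_{xe}·P_{ye} − P_{xy}. -/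
open MvPolynomial

/-- The Plücker coordinate `P_{xy} = z_{1x} z_{2y} − z_{1y} z_{2x}` of a generic `2 × m`
matrix of indeterminates (entries `z_{rc}` indexed by pairs `(r, c)`). -/
noncomputable def P2 (x y : ℕ) : MvPolynomial (ℕ × ℕ) ℂ :=
  X (1, x) * X (2, y) - X (1, y) * X (2, x)

/-- `P_{x ȳ} := P_{xe} · P_{ye} − P_{xy}` for a fixed column `e`. -/
noncomputable def Pbar (e x y : ℕ) : MvPolynomial (ℕ × ℕ) ℂ :=
  P2 x e * P2 y e - P2 x y

/-- Type `B_n` exchange identity (6.3.10):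
`P_{a c̄} · P_{bd} = P_{a b̄} · P_{cd} + P_{a d̄} · P_{bc}` for `1 ≤ a < b < c < d < e ≤ m`. -/
theorem typeB_exchange_6_3_10 (m a b c d e : ℕ) (h1 : 1 ≤ a) (h2 : a < b) (h3 : b < c)
    (h4 : c < d) (h5 : d < e) (h6 : e ≤ m) :
    Pbar e a c * P2 b d = Pbar e a b * P2 c d + Pbar e a d * P2 b c := by
  simp only [Pbar, P2]
  ring
end

section
/- Let 1 ≤ a < b < c < d < e ≤ m. Then in the polynomial ring ℂ[z_{rc}] the identity P_{a c̄}·P_{b d̄} = P_{ab}·P_{cd} + P_{a d̄}·P_{b c̄} holds, where P_{x ȳ} := P_{xe}·P_{ye} − P_{xy}. -/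
open MvPolynomial

/-- Type `B_n` exchange identity (6.3.11):
`P_{a c̄} · P_{b d̄} = P_{ab} · P_{cd} + P_{a d̄} · P_{b c̄}` for `1 ≤ a < b < c < d < e ≤ m`. -/
theorem typeB_exchange_6_3_11 (m a b c d e : ℕ) (h1 : 1 ≤ a) (h2 : a < b) (h3 : b < c)
    (h4 : c < d) (h5 : d < e) (h6 : e ≤ m) :
    Pbar e a c * Pbar e b d = P2 a b * P2 c d + Pbar e a d * Pbar e b c := by
  simp only [Pbar, P2]
  ring
end

section
/- Let 1 ≤ a < b < c < e ≤ m. Then in the polynomial ring ℂ[z_{rc}] the identity P_{a b̄}·P_{b c̄} = P_{ab}·P_{bc} + P_{be}²·P_{a c̄} holds, where P_{x ȳ} := P_{xe}·P_{ye} − P_{xy}. -/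
open MvPolynomial

/-- Type `B_n` exchange identity (6.3.13):
`P_{a b̄} · P_{b c̄} = P_{ab} · P_{bc} + P_{be}² · P_{a c̄}` for `1 ≤ a < b < c < e ≤ m`. -/
theorem typeB_exchange_6_3_13 (m a b c e : ℕ) (h1 : 1 ≤ a) (h2 : a < b) (h3 : b < c)
    (h4 : c < e) (h5 : e ≤ m) :
    Pbar e a b * Pbar e b c = P2 a b * P2 b c + (P2 b e) ^ 2 * Pbar e a c := by
  unfold Pbar P2
  ring
end

section
/- Let k ≥ 4 and let z be a k×k matrix of indeterminates over ℂ. Let b, c be integers with 2 ≤ b < c ≤ k−1, set a = b−1, d = c+1, and J = {b+1, b+2, …, c−1} (possibly empty). Then the following identity of flag minors holds in the polynomial ring ℂ[z_{ij}]: P_{J∪{b,c}} · ( −P_{J∪{a}}·P_{J∪{b,c,d}} + P_{J∪{b}}·P_{J∪{a,c,d}} ) = P_{J∪{a,b,c}}·P_{J∪{c,d}}·P_{J∪{b}} + P_{J∪{a,b}}·P_{J∪{b,c,d}}·P_{J∪{c}}. -/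
open MvPolynomial

/-- The flag minor `P_S` of a generic matrix of indeterminates (entries indexed by
pairs `(row, column)` of positive integers): the determinant of the submatrix
occupying the columns in `S` (in increasing order) and the rows `1, 2, …, |S|`. -/
noncomputable def flagMinor (S : Finset ℕ) : MvPolynomial (ℕ × ℕ) ℂ :=
  Matrix.det (Matrix.of fun r c : Fin S.card => X ((r : ℕ) + 1, S.orderEmbOfFin rfl c))

/-- The determinant formed by the first `l.length` rows of `M` and the columns listed in `l`. -/
noncomputable def listMinor {R : Type*} [CommRing R] (M : ℕ → ℕ → R) (l : List ℕ) : R :=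
  Matrix.det (Matrix.of fun r c : Fin l.length => M r l[c])

section listMinor

variable {R : Type*} [CommRing R] (M : ℕ → ℕ → R)

theorem listMinor_eq_det {n : ℕ} (l : List ℕ) (h : l.length = n) :
    listMinor M l = Matrix.det (Matrix.of fun r c : Fin n => M r (l[(c : ℕ)]'(h ▸ c.2))) := by
  subst h
  rfl

theorem map_listMinor {S : Type*} [CommRing S] (φ : R →+* S) (l : List ℕ) :
    φ (listMinor M l) = listMinor (fun i j => φ (M i j)) l := by
  rw [listMinor, listMinor, RingHom.map_det]
  rfl

/-- Moving the first column to the end. -/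
theorem listMinor_cons (x : ℕ) (l : List ℕ) :
    listMinor M (x :: l) = (-1) ^ l.length * listMinor M (l ++ [x]) := by
  have key : listMinor M (l ++ [x]) = (-1) ^ l.length * listMinor M (x :: l) := by
    rw [listMinor_eq_det M (l ++ [x]) (n := l.length + 1) (by simp),
      listMinor_eq_det M (x :: l) (n := l.length + 1) (by simp)]
    have h := Matrix.det_permute' (finRotate (l.length + 1))
      (Matrix.of fun r c : Fin (l.length + 1) => M r ((x :: l)[(c : ℕ)]'c.2))
    rw [sign_finRotate] at h
    push_cast at h
    rw [← h]
    congr 1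
    ext r c
    refine Fin.lastCases ?_ (fun i => ?_) c
    · simp
    · simp [Matrix.submatrix_apply]
  rw [key, ← mul_assoc, ← mul_pow]
  simp

/-- The Schur complement: minors containing the columns `J` are, up to the factor given by the
minor of `J`, minors of a fixed smaller array. -/
theorem exists_listMinor_append_eq {K : Type*} [Field K] (M : ℕ → ℕ → K) (J : List ℕ)
    (hJ : listMinor M J ≠ 0) :
    ∃ s : ℕ → ℕ → K, ∀ T : List ℕ, listMinor M (J ++ T) = listMinor M J * listMinor s T := by
  set A : Matrix (Fin J.length) (Fin J.length) K := Matrix.of fun r c => M r J[c] with hA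
  have hdet : IsUnit A.det := hJ.isUnit
  let _ : Invertible A := Matrix.invertibleOfIsUnitDet A hdet
  refine ⟨fun i t => M (J.length + i) t -
    ∑ k, (∑ j : Fin J.length, M (J.length + i) J[j] * (⅟A) j k) * M k t, fun T => ?_⟩
  rw [listMinor_eq_det M (J ++ T) List.length_append,
    ← Matrix.det_submatrix_equiv_self finSumFinEquiv]
  have hblocks : (Matrix.of fun r c : Fin (J.length + T.length) =>
      M r ((J ++ T)[(c : ℕ)]'(by simp))).submatrix finSumFinEquiv finSumFinEquiv =
      Matrix.fromBlocks A (Matrix.of fun (r : Fin J.length) (c : Fin T.length) => M r T[c])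
        (Matrix.of fun (r : Fin T.length) (c : Fin J.length) => M (J.length + r) J[c])
        (Matrix.of fun r c : Fin T.length => M (J.length + r) T[c]) := by
    ext r c
    rcases r with r | r <;> rcases c with c | c <;> simp [hA]
  rw [hblocks, Matrix.det_fromBlocks₁₁]
  rfl

end listMinor

theorem flagMinor_eq_listMinor {S : Finset ℕ} {l : List ℕ} (hS : S = l.toFinset)
    (hl : l.Pairwise (· < ·)) :
    flagMinor S = listMinor (fun i j => X (i + 1, j)) l := by
  have hsort : S.sort = l := by
    rw [hS]
    exact (List.toFinset_sort (· ≤ ·) (hl.imp ne_of_lt)).2 (hl.imp le_of_lt)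
  have hcard : l.length = S.card := by rw [← hsort, Finset.length_sort]
  rw [listMinor_eq_det _ l hcard]
  subst hsort
  rfl

theorem listMinor_X_range'_ne_zero (b n : ℕ) :
    listMinor (fun i j => (X (i + 1, j) : MvPolynomial (ℕ × ℕ) ℂ)) (List.range' (b + 1) n) ≠ 0 := by
  intro h
  have h' := congrArg (eval fun p : ℕ × ℕ => if p.1 + b = p.2 then (1 : ℂ) else 0) h
  rw [map_listMinor, listMinor_eq_det _ _ List.length_range', map_zero] at h'
  have hone : (Matrix.of fun r c : Fin n =>
      eval (fun p : ℕ × ℕ => if p.1 + b = p.2 then (1 : ℂ) else 0)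
        (X ((r : ℕ) + 1, (List.range' (b + 1) n)[(c : ℕ)]'(by simp)))) = 1 := by
    ext r c
    have hrc : ((r : ℕ) + 1 + b = b + 1 + c) ↔ r = c := by
      rw [Fin.ext_iff]
      omega
    simp [Matrix.one_apply, hrc]
  rw [hone, Matrix.det_one] at h'
  exact one_ne_zero h'

/-- The identity of flag minors underlying the exchange relation for `P_{J∪{b,c}}`
in the cluster structure on `ℂ[SL_k]^U` (Lemma in Section 6.5): with `a = b−1`,
`d = c+1`, `J = {b+1,…,c−1}`,
`P_{J∪{b,c}} · (−P_{J∪{a}}·P_{J∪{b,c,d}} + P_{J∪{b}}·P_{J∪{a,c,d}})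
  = P_{J∪{a,b,c}}·P_{J∪{c,d}}·P_{J∪{b}} + P_{J∪{a,b}}·P_{J∪{b,c,d}}·P_{J∪{c}}`. -/
theorem flagMinor_exchange_identity (k b c : ℕ) (hk : 4 ≤ k) (hb : 2 ≤ b) (hbc : b < c)
    (hc : c ≤ k - 1) :
    flagMinor (Finset.Ioo b c ∪ {b, c}) *
        (-(flagMinor (Finset.Ioo b c ∪ {b - 1})) *
            flagMinor (Finset.Ioo b c ∪ {b, c, c + 1}) +
          flagMinor (Finset.Ioo b c ∪ {b}) *
            flagMinor (Finset.Ioo b c ∪ {b - 1, c, c + 1})) =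
      flagMinor (Finset.Ioo b c ∪ {b - 1, b, c}) * flagMinor (Finset.Ioo b c ∪ {c, c + 1}) *
          flagMinor (Finset.Ioo b c ∪ {b}) +
        flagMinor (Finset.Ioo b c ∪ {b - 1, b}) * flagMinor (Finset.Ioo b c ∪ {b, c, c + 1}) *
          flagMinor (Finset.Ioo b c ∪ {c}) := by
  obtain ⟨a, rfl⟩ : ∃ a, b = a + 1 := ⟨b - 1, by omega⟩
  rw [Nat.add_sub_cancel]
  set J := List.range' (a + 1 + 1) (c - (a + 1) - 1) with hJ
  have flag (L U : List ℕ) (T : Finset ℕ) (hT : T = L.toFinset ∪ U.toFinset)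
      (hL : L.Pairwise (· < ·)) (hU : U.Pairwise (· < ·)) (hLa : ∀ x ∈ L, x ≤ a + 1)
      (hUc : ∀ x ∈ U, c ≤ x) :
      flagMinor (Finset.Ioo (a + 1) c ∪ T) =
        listMinor (fun i j => X (i + 1, j)) (L ++ (J ++ U)) := by
    apply flagMinor_eq_listMinor
    · subst hT
      ext x
      simp only [Finset.mem_union, Finset.mem_Ioo, List.mem_toFinset, List.mem_append, hJ,
        List.mem_range'_1]
      have : a + 1 < x ∧ x < c ↔
          a + 1 + 1 ≤ x ∧ x < a + 1 + 1 + (c - (a + 1) - 1) := by omega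
      rw [this]
      tauto
    · simp only [List.pairwise_append, List.mem_append, hJ, List.mem_range'_1]
      refine ⟨hL, ⟨List.pairwise_lt_range', hU, fun x hx y hy => ?_⟩, fun x hx y hy => ?_⟩
      · have := hUc y hy
        omega
      · have := hLa x hx
        rcases hy with hy | hy
        · omega
        · have := hUc y hy
          omega
  rw [flag [a + 1] [c] _ (by ext; simp) (by simp) (by simp) (by simp) (by simp),
    flag [a] [] _ (by ext; simp) (by simp) (by simp) (by simp) (by simp),
    flag [a + 1] [c, c + 1] _ (by ext; simp; tauto) (by simp) (by simp) (by simp) (by simp),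
    flag [a + 1] [] _ (by ext; simp) (by simp) (by simp) (by simp) (by simp),
    flag [a] [c, c + 1] _ (by ext; simp; tauto) (by simp) (by simp) (by simp) (by simp),
    flag [a, a + 1] [c] _ (by ext; simp) (by simp) (by simp) (by simp) (by simp),
    flag [] [c, c + 1] _ (by ext; simp) (by simp) (by simp) (by simp) (by simp),
    flag [a, a + 1] [] _ (by ext; simp) (by simp) (by simp) (by simp) (by simp),
    flag [] [c] _ (by ext; simp) (by simp) (by simp) (by simp) (by simp)]
  let K := FractionRing (MvPolynomial (ℕ × ℕ) ℂ)
  have hinj : Function.Injective (algebraMap (MvPolynomial (ℕ × ℕ) ℂ) K) :=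
    IsFractionRing.injective _ _
  obtain ⟨s, hs⟩ := exists_listMinor_append_eq
    (fun i j => algebraMap (MvPolynomial (ℕ × ℕ) ℂ) K (X (i + 1, j))) J (by
      rw [← map_listMinor]
      exact (map_ne_zero_iff _ hinj).2 (listMinor_X_range'_ne_zero _ _))
  apply hinj
  have rotate := listMinor_cons
    (fun i j => algebraMap (MvPolynomial (ℕ × ℕ) ℂ) K (X (i + 1, j)))
  have one (x : ℕ) : listMinor s [x] = s 0 x := by simp [listMinor]
  have two (x y : ℕ) : listMinor s [x, y] = s 0 x * s 1 y - s 0 y * s 1 x := by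
    simp [listMinor, Matrix.det_fin_two]
  have three (x y z : ℕ) : listMinor s [x, y, z] =
      s 0 x * s 1 y * s 2 z - s 0 x * s 1 z * s 2 y - s 0 y * s 1 x * s 2 z
        + s 0 y * s 1 z * s 2 x + s 0 z * s 1 x * s 2 y - s 0 z * s 1 y * s 2 x := by
    simp [listMinor, Matrix.det_fin_three]
  simp only [map_mul, map_add, map_neg, map_listMinor, List.cons_append, List.nil_append,
    rotate, List.append_assoc, List.append_nil, hs, one, two, three, List.length_append,
    List.length_cons, List.length_nil, pow_add]
  ring
end

section
/- Let k ≥ 2 and let f be a polynomial function on k×k complex matrices (i.e., f is given by a polynomial in the k² matrix entries) such that f(u·z) = f(z) for every lower-triangular unipotent matrix u (u_{ii}=1 for all i and u_{ij}=0 for i<j) and every z ∈ SL_k(ℂ). Then there exists a polynomial g in variables indexed by the nonempty proper subsets J of {1,…,k} such that f(z) = g( (P_J(z))_J ) for all z ∈ SL_k(ℂ). In other words, the ring of U-invariant regular functions ℂ[SL_k]^U is generated by the 2^k − 2 flag minors P_J. -/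
open MvPolynomial

/-- The flag minor `P_J(z)` of a `k×k` complex matrix `z`: the determinant of the
submatrix of `z` occupying the columns in `J` (in increasing order) and the rows
`1, 2, …, |J|`. -/
noncomputable def flagMinorEval {k : ℕ} (z : Matrix (Fin k) (Fin k) ℂ) (J : Finset (Fin k)) :
    ℂ :=
  Matrix.det (Matrix.of fun r c : Fin J.card =>
    z (Fin.castLE (by simpa using J.card_le_univ) r) (J.orderEmbOfFin rfl c))

theorem sum_pow_mul_lagrangeBasis_comp_neg (D q : ℕ) (hq : q ≤ D) :
    ∑ i ∈ Finset.range (D + 1), (Polynomial.C (i : ℂ) + Polynomial.X) ^ q *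
      (Lagrange.basis (Finset.range (D + 1)) (fun i : ℕ => (i : ℂ)) i).comp (-Polynomial.X) =
    if q = 0 then 1 else 0 := by
  refine Polynomial.funext fun t => ?_
  have h := Lagrange.eq_interpolate_of_eval_eq (s := Finset.range (D + 1))
    (v := fun i : ℕ => (i : ℂ)) (f := (Polynomial.X + Polynomial.C t) ^ q)
    (fun i => ((i : ℂ) + t) ^ q) (fun a _ b _ hab => Nat.cast_injective hab)
    (by
      rw [Polynomial.degree_pow, Polynomial.degree_X_add_C, Finset.card_range]
      simp only [nsmul_eq_mul, mul_one]
      exact_mod_cast Nat.lt_succ_of_le hq)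
    (by intro i _; simp)
  have h' := congrArg (Polynomial.eval (-t)) h
  rw [Lagrange.interpolate_apply, Polynomial.eval_finsetSum] at h'
  simp only [Polynomial.eval_mul, Polynomial.eval_C, Polynomial.eval_pow, Polynomial.eval_add,
    Polynomial.eval_X, neg_add_cancel] at h'
  rw [Polynomial.eval_finsetSum]
  simp only [Polynomial.eval_mul, Polynomial.eval_C, Polynomial.eval_pow, Polynomial.eval_add,
    Polynomial.eval_X, Polynomial.eval_comp, Polynomial.eval_neg]
  rw [← h', zero_pow_eq]
  split_ifs <;> simp

/-- If `(s + X) ^ b * ∑ p, (s + X) ^ p * H p` has degree at most `m` for all `s`, then Lagrange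
interpolation in `s` at `s = -X` bounds the degree of `H 0`. -/
theorem natDegree_le_of_shifted_sum (H : ℕ → Polynomial ℂ) (D b m : ℕ)
    (hG : ∀ s : ℂ, ((Polynomial.C s + Polynomial.X) ^ b *
      ∑ p ∈ Finset.range (D + 1), (Polynomial.C s + Polynomial.X) ^ p * H p).natDegree ≤ m)
    (h0 : H 0 ≠ 0) : b ≤ m ∧ (H 0).natDegree ≤ m - b + D := by
  set Q : ℂ → Polynomial ℂ := fun s =>
    ∑ p ∈ Finset.range (D + 1), (Polynomial.C s + Polynomial.X) ^ p * H p with hQ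
  set ℓ : ℕ → Polynomial ℂ := fun i =>
    (Lagrange.basis (Finset.range (D + 1)) (fun i : ℕ => (i : ℂ)) i).comp (-Polynomial.X) with hℓ
  have hsum : H 0 = ∑ i ∈ Finset.range (D + 1), Q i * ℓ i := by
    calc H 0 = ∑ p ∈ Finset.range (D + 1), (if p = 0 then 1 else 0) * H p := by simp
      _ = ∑ p ∈ Finset.range (D + 1), ∑ i ∈ Finset.range (D + 1),
            (Polynomial.C (i : ℂ) + Polynomial.X) ^ p * H p * ℓ i := by
          refine Finset.sum_congr rfl fun p hp => ?_
          rw [← sum_pow_mul_lagrangeBasis_comp_neg D p (by simpa [Nat.lt_succ_iff] using hp),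
            Finset.sum_mul]
          exact Finset.sum_congr rfl fun i _ => by ring
      _ = _ := by
          rw [Finset.sum_comm]
          exact Finset.sum_congr rfl fun i _ => (Finset.sum_mul _ _ _).symm
  have hdeg : ∀ s : ℂ, Q s ≠ 0 → b + (Q s).natDegree ≤ m := by
    intro s hs
    have hmonic : (Polynomial.C s + Polynomial.X : Polynomial ℂ).Monic := by
      rw [add_comm]; exact Polynomial.monic_X_add_C s
    have := hG s
    rw [(hmonic.pow b).natDegree_mul' hs, hmonic.natDegree_pow, add_comm (Polynomial.C s),
      Polynomial.natDegree_X_add_C, mul_one] at this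
    exact this
  have hb : b ≤ m := by
    by_contra hbm
    refine h0 (hsum.trans (Finset.sum_eq_zero fun i _ => ?_))
    have : Q i = 0 := by
      by_contra hne
      have := hdeg _ hne
      omega
    rw [this, zero_mul]
  refine ⟨hb, ?_⟩
  rw [hsum]
  refine Polynomial.natDegree_sum_le_of_forall_le _ _ fun i hi => ?_
  by_cases hne : Q i = 0
  · simp [hne]
  refine Polynomial.natDegree_mul_le.trans (add_le_add ?_ ?_)
  · have := hdeg _ hne
    omega
  · refine Polynomial.natDegree_comp_le.trans ?_
    rw [Polynomial.natDegree_neg, Polynomial.natDegree_X, mul_one]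
    refine Polynomial.natDegree_le_of_degree_le ?_
    rw [Lagrange.degree_basis (fun a _ b _ hab => Nat.cast_injective hab) hi]
    simp

theorem aeval_C_add_X_cons {n : ℕ} (g : MvPolynomial (Fin (n + 1)) ℂ) (s : ℂ) (y : Fin n → ℂ) :
    aeval (fun c => Polynomial.C ((Fin.cons s y : Fin (n + 1) → ℂ) c) + Polynomial.X) g =
      (finSuccEquiv ℂ n g).eval₂
        (aeval (fun c => Polynomial.C (y c) + Polynomial.X) :
          MvPolynomial (Fin n) ℂ →ₐ[ℂ] Polynomial ℂ).toRingHom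
        (Polynomial.C s + Polynomial.X) := by
  induction g using MvPolynomial.induction_on with
  | C a => simp [finSuccEquiv_apply]
  | add p q hp hq => simp only [map_add, hp, hq, Polynomial.eval₂_add]
  | mul_X p i hp =>
    rw [map_mul, map_mul, hp, Polynomial.eval₂_mul]
    congr 1
    refine Fin.cases ?_ (fun j => ?_) i <;> simp [finSuccEquiv_apply]

/-- Let `b` be the lexicographically least exponent of `g`, let `N c` bound the degree of `g` in the
variable `c`, and suppose that `g (y + t)` has degree at most `m` in the simultaneous translation
parameter `t`. Then the partial sums of `b` are bounded in terms of `m` and those of `N`. -/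
theorem ballot_of_natDegree_translate_le {n : ℕ} (g : MvPolynomial (Fin n) ℂ) (b N : Fin n → ℕ)
    (m : ℕ)
    (hm : ∀ y : Fin n → ℂ,
      (aeval (fun c => Polynomial.C (y c) + Polynomial.X) g : Polynomial ℂ).natDegree ≤ m)
    (hb : coeff (Finsupp.equivFunOnFinite.symm b) g ≠ 0)
    (hN : ∀ e ∈ g.support, ∀ c, e c ≤ N c)
    (hmin : ∀ e ∈ g.support, ∀ c, (∀ c' < c, e c' = b c') → b c ≤ e c) (j : Fin n) :
    ∑ c ∈ Finset.Iic j, b c + ∑ c ∈ Finset.Iio j, b c ≤ m + ∑ c ∈ Finset.Iio j, N c := by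
  induction n generalizing m with
  | zero => exact j.elim0
  | succ n ih =>
    set h : ℕ → MvPolynomial (Fin n) ℂ := fun q => (finSuccEquiv ℂ n g).coeff q with hh
    have hbN : b 0 ≤ N 0 := hN _ (mem_support_iff.2 hb) 0
    have hcoeff : ∀ q e, coeff e (h q) = coeff (e.cons q) g := fun q e =>
      finSuccEquiv_coeff_coeff e g q
    have hlow : ∀ q < b 0, h q = 0 := by
      intro q hq
      ext e
      rw [hcoeff, coeff_zero]
      by_contra hne
      have := hmin _ (mem_support_iff.2 hne) 0 (fun c' hc' => absurd hc' (Fin.not_lt_zero _))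
      rw [Finsupp.cons_zero] at this
      omega
    have hhigh : ∀ q, N 0 < q → h q = 0 := by
      intro q hq
      ext e
      rw [hcoeff, coeff_zero]
      by_contra hne
      have := hN _ (mem_support_iff.2 hne) 0
      rw [Finsupp.cons_zero] at this
      omega
    have htail : Finsupp.equivFunOnFinite.symm b =
        (Finsupp.equivFunOnFinite.symm (fun c => b (Fin.succ c))).cons (b 0) := by
      ext c
      refine Fin.cases ?_ (fun c => ?_) c <;> simp
    have hb0 : coeff (Finsupp.equivFunOnFinite.symm fun c => b (Fin.succ c)) (h (b 0)) ≠ 0 := by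
      rw [hcoeff, ← htail]; exact hb
    have hstep : ∀ y : Fin n → ℂ,
        (aeval (fun c => Polynomial.C (y c) + Polynomial.X) (h (b 0)) : Polynomial ℂ) ≠ 0 →
        b 0 ≤ m ∧ (aeval (fun c => Polynomial.C (y c) + Polynomial.X) (h (b 0)) :
          Polynomial ℂ).natDegree ≤ m - b 0 + (N 0 - b 0) := by
      intro y hy
      refine natDegree_le_of_shifted_sum
        (fun p => aeval (fun c => Polynomial.C (y c) + Polynomial.X) (h (b 0 + p)))
        (N 0 - b 0) (b 0) m (fun s => ?_) (by simpa using hy)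
      have := hm (Fin.cons s y)
      rw [aeval_C_add_X_cons, Polynomial.eval₂_eq_sum_range' _ (n := b 0 + (N 0 - b 0 + 1)),
        Finset.sum_range_add, Finset.sum_eq_zero, zero_add] at this
      · convert this using 2
        rw [Finset.mul_sum]
        refine Finset.sum_congr rfl fun p _ => ?_
        rw [pow_add]
        simp only [AlgHom.toRingHom_eq_coe, RingHom.coe_coe, hh]
        ring
      · intro q hq
        have := hlow q (Finset.mem_range.1 hq)
        simp only [hh] at this
        rw [this]; simp
      · rw [Nat.lt_iff_le_pred (by omega), Polynomial.natDegree_le_iff_coeff_eq_zero]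
        intro q hq
        exact hhigh q (by omega)
    have hbm : b 0 ≤ m := by
      have hne : h (b 0) ≠ 0 := fun h0 => hb0 (by rw [h0, coeff_zero])
      obtain ⟨y, hy⟩ : ∃ y, eval y (h (b 0)) ≠ 0 := by
        by_contra! hall
        exact hne (MvPolynomial.funext fun y => by rw [hall, map_zero])
      refine (hstep y fun h0 => hy ?_).1
      have := congrArg (Polynomial.eval 0) h0
      rw [← Polynomial.coe_aeval_eq_eval, ← AlgHom.comp_apply, comp_aeval] at this
      simpa [aeval_eq_eval] using this
    refine Fin.cases ?_ (fun j => ?_) j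
    · have h1 : Finset.Iic (0 : Fin (n + 1)) = {0} := by ext; simp
      have h2 : Finset.Iio (0 : Fin (n + 1)) = ∅ := by ext; simp
      simpa [h1, h2] using hbm
    · have key := ih (h (b 0)) (fun c => b c.succ) (fun c => N c.succ) (m - b 0 + (N 0 - b 0))
        (fun y => by
          by_cases h0 : (aeval (fun c => Polynomial.C (y c) + Polynomial.X) (h (b 0)) :
            Polynomial ℂ) = 0
          · simp [h0]
          · exact (hstep y h0).2)
        hb0
        (fun e he c => by
          have := hN (e.cons (b 0)) (by
            rw [mem_support_iff, ← hcoeff]; exact mem_support_iff.1 he) c.succ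
          simpa using this)
        (fun e he c hc => by
          have := hmin (e.cons (b 0)) (by
            rw [mem_support_iff, ← hcoeff]; exact mem_support_iff.1 he) c.succ (by
              intro c'
              refine Fin.cases ?_ (fun c' hc' => ?_) c'
              · simp
              · simpa using hc c' (by simpa using hc'))
          simpa using this) j
      have h1 : ∀ w : Fin (n + 1) → ℕ, ∑ c ∈ Finset.Iic j.succ, w c =
          w 0 + ∑ c ∈ Finset.Iic j, w c.succ := by
        intro w
        rw [show Finset.Iic j.succ = Finset.univ.filter (· ≤ j.succ) by ext; simp,
          show Finset.Iic j = Finset.univ.filter (· ≤ j) by ext; simp,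
          Finset.sum_filter, Finset.sum_filter, Fin.sum_univ_succ]
        simp
      have h2 : ∀ w : Fin (n + 1) → ℕ, ∑ c ∈ Finset.Iio j.succ, w c =
          w 0 + ∑ c ∈ Finset.Iio j, w c.succ := by
        intro w
        rw [show Finset.Iio j.succ = Finset.univ.filter (· < j.succ) by ext; simp,
          show Finset.Iio j = Finset.univ.filter (· < j) by ext; simp,
          Finset.sum_filter, Finset.sum_filter, Fin.sum_univ_succ]
        simp
      rw [h1, h2, h2]
      omega

/-- Evaluation of a polynomial in the matrix entries at a matrix. The variable of the entry in row
`r` and column `c` is indexed by `toLex (c, r)`, so that entries are ordered column by column. -/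
noncomputable def evalMat {k : ℕ} (z : Matrix (Fin k) (Fin k) ℂ) :
    MvPolynomial (Fin k ×ₗ Fin k) ℂ →ₐ[ℂ] ℂ :=
  aeval fun s => z (ofLex s).2 (ofLex s).1

/-- Invariance under adding a multiple of a row to a lower row. -/
def RowInvariant {k : ℕ} (f : MvPolynomial (Fin k ×ₗ Fin k) ℂ) : Prop :=
  ∀ (x y : Fin k), x < y → ∀ (t : ℂ) (z : Matrix (Fin k) (Fin k) ℂ),
    evalMat (z.updateRow y (z y + t • z x)) f = evalMat z f

/-- The exponents of products of leading monomials of flag minors: reading each row as a weakly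
increasing word in the column indices, the rows form a semistandard tableau. -/
def IsBallot {k : ℕ} (M : Fin k ×ₗ Fin k →₀ ℕ) : Prop :=
  ∀ x y : Fin k, x < y → ∀ j : Fin k,
    ∑ c ∈ Finset.Iic j, M (toLex (c, y)) ≤ ∑ c ∈ Finset.Iio j, M (toLex (c, x))

theorem evalMat_eq_sum {k : ℕ} (z : Matrix (Fin k) (Fin k) ℂ)
    (f : MvPolynomial (Fin k ×ₗ Fin k) ℂ) :
    evalMat z f = ∑ e ∈ f.support, coeff e f * ∏ s, z (ofLex s).2 (ofLex s).1 ^ e s := by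
  rw [evalMat, aeval_eq_eval, eval_eq']

theorem evalMat_funext {k : ℕ} {f g : MvPolynomial (Fin k ×ₗ Fin k) ℂ}
    (h : ∀ z, evalMat z f = evalMat z g) : f = g := by
  refine MvPolynomial.funext fun w => ?_
  simpa [evalMat, aeval_eq_eval] using h (Matrix.of fun r c => w (toLex (c, r)))

/-- Move the entries of row `y` to row `x`, keeping their columns. -/
def mergeRow {k : ℕ} (x y : Fin k) (s : Fin k ×ₗ Fin k) : Fin k ×ₗ Fin k :=
  if (ofLex s).2 = y then toLex ((ofLex s).1, x) else s

theorem mapDomain_mergeRow_apply_same {k : ℕ} {x y : Fin k} (hxy : x ≠ y)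
    (e : Fin k ×ₗ Fin k →₀ ℕ) (c : Fin k) :
    e.mapDomain (mergeRow x y) (toLex (c, x)) = e (toLex (c, x)) + e (toLex (c, y)) := by
  classical
  rw [Finsupp.mapDomain, Finsupp.sum_apply, Finsupp.sum_fintype _ _ (by simp)]
  simp only [Finsupp.single_apply]
  rw [← Finset.sum_filter, ← Finset.sum_pair (f := e) (a := toLex (c, x)) (b := toLex (c, y))]
  · refine Finset.sum_congr ?_ fun _ _ => rfl
    ext s
    induction s using Lex.rec with | h s => ?_
    obtain ⟨c', r⟩ := s
    rw [Finset.mem_filter]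
    by_cases hr : r = y <;> simp [mergeRow, hr, hxy.symm]
  · simpa using hxy

theorem mapDomain_mergeRow_apply_of_ne {k : ℕ} {x y r : Fin k} (hx : r ≠ x) (hy : r ≠ y)
    (e : Fin k ×ₗ Fin k →₀ ℕ) (c : Fin k) :
    e.mapDomain (mergeRow x y) (toLex (c, r)) = e (toLex (c, r)) := by
  classical
  rw [Finsupp.mapDomain, Finsupp.sum_apply, Finsupp.sum_fintype _ _ (by simp)]
  simp only [Finsupp.single_apply]
  rw [← Finset.sum_filter, ← Finset.sum_singleton e (toLex (c, r))]
  refine Finset.sum_congr ?_ fun _ _ => rfl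
  ext s
  induction s using Lex.rec with | h s => ?_
  obtain ⟨c', r'⟩ := s
  rw [Finset.mem_filter]
  by_cases hr : r' = y
  · subst hr; simp [mergeRow, hx.symm, hy.symm]
  · simp [mergeRow, hr]

theorem prod_lex_row_pow {k : ℕ} (y : Fin k) (v : Fin k → ℂ) (e : Fin k ×ₗ Fin k →₀ ℕ) :
    ∏ s, (if (ofLex s).2 = y then v (ofLex s).1 else 1) ^ e s =
      ∏ c, v c ^ e (toLex (c, y)) := by
  rw [← Equiv.prod_comp toLex, Fintype.prod_prod_type]
  refine Finset.prod_congr rfl fun c _ => ?_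
  rw [Finset.prod_eq_single y] <;> simp +contextual

/-- The row `y` of an exponent. -/
noncomputable def rowExponent {k : ℕ} (y : Fin k) (e : Fin k ×ₗ Fin k →₀ ℕ) : Fin k →₀ ℕ :=
  Finsupp.equivFunOnFinite.symm fun c => e (toLex (c, y))

theorem eq_of_mapDomain_mergeRow_eq {k : ℕ} {x y : Fin k} (hxy : x ≠ y)
    {e e' : Fin k ×ₗ Fin k →₀ ℕ}
    (h : e.mapDomain (mergeRow x y) = e'.mapDomain (mergeRow x y))
    {c : Fin k} (hc : e (toLex (c, y)) = e' (toLex (c, y))) (r : Fin k) :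
    e (toLex (c, r)) = e' (toLex (c, r)) := by
  by_cases hy : r = y
  · rw [hy, hc]
  by_cases hx : r = x
  · have := DFunLike.congr_fun h (toLex (c, x))
    rw [mapDomain_mergeRow_apply_same hxy, mapDomain_mergeRow_apply_same hxy] at this
    rw [hx]; omega
  · have := DFunLike.congr_fun h (toLex (c, r))
    rwa [mapDomain_mergeRow_apply_of_ne hx hy, mapDomain_mergeRow_apply_of_ne hx hy] at this

/-- The part of `f` with the exponent of `M` outside the rows `x` and `y` and with its column sums on
these two rows, dehomogenized by setting the variables outside row `y` to `1`. -/
noncomputable def rowSlice {k : ℕ} (x y : Fin k) (f : MvPolynomial (Fin k ×ₗ Fin k) ℂ)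
    (M : Fin k ×ₗ Fin k →₀ ℕ) : MvPolynomial (Fin k) ℂ :=
  ∑ e ∈ f.support with e.mapDomain (mergeRow x y) = M.mapDomain (mergeRow x y),
    monomial (rowExponent y e) (coeff e f)

theorem coeff_rowSlice {k : ℕ} {x y : Fin k} (hxy : x ≠ y)
    (f : MvPolynomial (Fin k ×ₗ Fin k) ℂ) (M : Fin k ×ₗ Fin k →₀ ℕ) :
    coeff (rowExponent y M) (rowSlice x y f M) = coeff M f := by
  classical
  rw [rowSlice, coeff_sum, Finset.sum_eq_single M]
  · simp
  · intro e he hne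
    rw [coeff_monomial, if_neg]
    intro h
    refine hne (Finsupp.ext fun s => ?_)
    exact eq_of_mapDomain_mergeRow_eq hxy (Finset.mem_filter.1 he).2
      (DFunLike.congr_fun h (ofLex s).1) (ofLex s).2
  · intro h
    simpa using h

theorem exists_of_mem_support_rowSlice {k : ℕ} {x y : Fin k}
    {f : MvPolynomial (Fin k ×ₗ Fin k) ℂ} {M : Fin k ×ₗ Fin k →₀ ℕ} {d : Fin k →₀ ℕ}
    (hd : d ∈ (rowSlice x y f M).support) :
    ∃ e ∈ f.support, e.mapDomain (mergeRow x y) = M.mapDomain (mergeRow x y) ∧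
      ∀ c, d c = e (toLex (c, y)) := by
  classical
  rw [mem_support_iff, rowSlice, coeff_sum] at hd
  obtain ⟨e, he, hne⟩ := Finset.exists_ne_zero_of_sum_ne_zero hd
  rw [Finset.mem_filter] at he
  refine ⟨e, he.1, he.2, fun c => ?_⟩
  rw [coeff_monomial] at hne
  rw [← (ite_ne_right_iff.1 hne).1]
  rfl

theorem eval_rowSlice_add {k : ℕ} {x y : Fin k} (hxy : x < y)
    {f : MvPolynomial (Fin k ×ₗ Fin k) ℂ} (hf : RowInvariant f) (M : Fin k ×ₗ Fin k →₀ ℕ)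
    (v : Fin k → ℂ) (t : ℂ) :
    eval (fun c => v c + t) (rowSlice x y f M) = eval v (rowSlice x y f M) := by
  classical
  set Θ : (Fin k → ℂ) → MvPolynomial (Fin k ×ₗ Fin k) ℂ := fun v =>
    ∑ e ∈ f.support, monomial (e.mapDomain (mergeRow x y))
      (coeff e f * ∏ c, v c ^ e (toLex (c, y))) with hΘ
  have hcoeff : ∀ v, coeff (M.mapDomain (mergeRow x y)) (Θ v) = eval v (rowSlice x y f M) := by
    intro v
    simp only [hΘ, coeff_sum, coeff_monomial, rowSlice, map_sum, eval_monomial]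
    rw [Finset.sum_filter]
    refine Finset.sum_congr rfl fun e _ => ?_
    rw [Finsupp.prod_fintype _ _ (by simp)]
    rfl
  have heval : ∀ v w, evalMat w (Θ v) =
      evalMat (w.updateRow y fun c => w x c * v c) f := by
    intro v w
    rw [evalMat_eq_sum (w.updateRow y fun c => w x c * v c) f]
    simp only [hΘ, map_sum, evalMat, aeval_monomial]
    refine Finset.sum_congr rfl fun e _ => ?_
    rw [Finsupp.prod_mapDomain_index (by simp) (by intros; rw [pow_add]),
      Finsupp.prod_fintype _ _ (by simp), ← prod_lex_row_pow,
      Algebra.algebraMap_self_apply, mul_assoc, ← Finset.prod_mul_distrib]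
    simp only [← mul_pow]
    congr 1
    refine Finset.prod_congr rfl fun s _ => ?_
    congr 1
    by_cases hs : (ofLex s).2 = y
    · simp [hs, mergeRow, mul_comm]
    · simp [hs, mergeRow]
  rw [← hcoeff, ← hcoeff]
  congr 1
  refine evalMat_funext fun w => ?_
  rw [heval, heval, ← hf x y hxy t (w.updateRow y fun c => w x c * v c)]
  congr 2
  ext r c
  by_cases hr : r = y
  · subst hr
    simp [hxy.ne]; ring
  · simp [hr]

/-- The leading exponent of an invariant is that of a semistandard tableau. -/
theorem RowInvariant.isBallot_degree {k : ℕ} {f : MvPolynomial (Fin k ×ₗ Fin k) ℂ}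
    (hf : RowInvariant f) (hf0 : f ≠ 0) : IsBallot (MonomialOrder.lex.degree f) := by
  intro x y hxy j
  set M := MonomialOrder.lex.degree f with hM
  have key := ballot_of_natDegree_translate_le (rowSlice x y f M) (rowExponent y M)
    (fun c => M (toLex (c, x)) + M (toLex (c, y))) 0
    (fun v => by
      have : (aeval (fun c => Polynomial.C (v c) + Polynomial.X) (rowSlice x y f M) :
          Polynomial ℂ) = Polynomial.C (eval v (rowSlice x y f M)) := by
        refine Polynomial.funext fun t => ?_
        rw [Polynomial.eval_C, ← eval_rowSlice_add hxy hf M v t, ← Polynomial.coe_aeval_eq_eval,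
          ← AlgHom.comp_apply, comp_aeval]
        simp [aeval_eq_eval]
      rw [this, Polynomial.natDegree_C])
    (by
      have := coeff_rowSlice hxy.ne f M
      rw [← MonomialOrder.leadingCoeff] at this
      simpa using this.trans_ne (MonomialOrder.leadingCoeff_ne_zero_iff.2 hf0))
    (fun d hd c => by
      obtain ⟨e, _, he, hde⟩ := exists_of_mem_support_rowSlice hd
      have := DFunLike.congr_fun he (toLex (c, x))
      rw [mapDomain_mergeRow_apply_same hxy.ne, mapDomain_mergeRow_apply_same hxy.ne] at this
      rw [hde]; omega)
    (fun d hd c hc => by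
      obtain ⟨e, hes, he, hde⟩ := exists_of_mem_support_rowSlice hd
      by_contra! hlt
      have hlt' : e (toLex (c, y)) < M (toLex (c, y)) := by rw [← hde]; exact hlt
      have hle := MonomialOrder.lex.le_degree hes
      rw [← hM] at hle
      refine hle.not_gt (MonomialOrder.lex_lt_iff.2 (Finsupp.Lex.lt_iff.2
        ⟨toLex (c, x), fun s hs => ?_, ?_⟩))
      · rw [Prod.Lex.lt_iff] at hs
        change M s = e s
        rcases hs with hs | ⟨hs, hr⟩
        · exact (eq_of_mapDomain_mergeRow_eq hxy.ne he
            ((hde _).symm.trans (hc _ hs)) (ofLex s).2).symm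
        · have hr : (ofLex s).2 < x := hr
          have := DFunLike.congr_fun he (toLex ((ofLex s).1, (ofLex s).2))
          rw [mapDomain_mergeRow_apply_of_ne hr.ne (hr.trans hxy).ne,
            mapDomain_mergeRow_apply_of_ne hr.ne (hr.trans hxy).ne] at this
          exact this.symm
      · have := DFunLike.congr_fun he (toLex (c, x))
        rw [mapDomain_mergeRow_apply_same hxy.ne, mapDomain_mergeRow_apply_same hxy.ne] at this
        change M (toLex (c, x)) < e (toLex (c, x))
        omega)
    j
  simp only [rowExponent, Finsupp.equivFunOnFinite_symm_apply_apply, Finset.sum_add_distrib] at key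
  omega

/-- The minor of the generic matrix on its first `r` rows and the columns `p`. -/
noncomputable def genericMinor {k r : ℕ} (hr : r ≤ k) (p : Fin r → Fin k) :
    MvPolynomial (Fin k ×ₗ Fin k) ℂ :=
  Matrix.det (Matrix.of fun a b : Fin r => X (toLex (p b, Fin.castLE hr a)))

/-- The exponent of the monomial of `genericMinor hr p` that belongs to `π`. -/
noncomputable def permExponent {k r : ℕ} (hr : r ≤ k) (p : Fin r → Fin k)
    (π : Equiv.Perm (Fin r)) : Fin k ×ₗ Fin k →₀ ℕ :=
  ∑ a, Finsupp.single (toLex (p a, Fin.castLE hr (π a))) 1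

theorem genericMinor_eq_sum {k r : ℕ} (hr : r ≤ k) (p : Fin r → Fin k) :
    genericMinor hr p = ∑ π : Equiv.Perm (Fin r),
      monomial (permExponent hr p π) (((Equiv.Perm.sign π : ℤ) : ℂ)) := by
  rw [genericMinor, Matrix.det_apply]
  refine Finset.sum_congr rfl fun π _ => ?_
  rw [permExponent, ← mul_one (((Equiv.Perm.sign π : ℤ) : ℂ)), ← smul_eq_mul, ← smul_monomial,
    monomial_sum_one, Units.smul_def, Int.cast_smul_eq_zsmul]
  rfl

theorem permExponent_apply {k r : ℕ} (hr : r ≤ k) (p : Fin r → Fin k)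
    (π : Equiv.Perm (Fin r)) (c i : Fin k) :
    permExponent hr p π (toLex (c, i)) =
      ∑ a, if p a = c ∧ Fin.castLE hr (π a) = i then 1 else 0 := by
  classical
  rw [permExponent, Finsupp.finsetSum_apply]
  refine Finset.sum_congr rfl fun a _ => ?_
  rw [Finsupp.single_apply]
  simp

theorem permExponent_lt {k r : ℕ} (hr : r ≤ k) {p : Fin r → Fin k} (hp : StrictMono p)
    {π : Equiv.Perm (Fin r)} (hπ : π ≠ 1) :
    MonomialOrder.lex.toSyn (permExponent hr p π) <
      MonomialOrder.lex.toSyn (permExponent hr p 1) := by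
  obtain ⟨i, hi, hmin⟩ : ∃ i, π i ≠ i ∧ ∀ j < i, π j = j := by
    obtain ⟨i₀, hi₀⟩ : ∃ i, π i ≠ i := by
      by_contra! h
      exact hπ (Equiv.ext h)
    obtain ⟨i, hi, hmin⟩ := WellFounded.has_min (wellFounded_lt (α := Fin r)) {i | π i ≠ i}
      ⟨i₀, hi₀⟩
    exact ⟨i, hi, fun j hj => by_contra fun hne => hmin j hne hj⟩
  have hgt : i < π i := by
    refine lt_of_le_of_ne (le_of_not_gt fun hlt => hi ?_) hi.symm
    exact π.injective (hmin _ hlt)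
  refine MonomialOrder.lex_lt_iff.2 (Finsupp.Lex.lt_iff.2
    ⟨toLex (p i, Fin.castLE hr i), fun s hs => ?_, ?_⟩)
  · induction s using Lex.rec with | h s => ?_
    obtain ⟨c, l⟩ := s
    change permExponent hr p π (toLex (c, l)) = permExponent hr p 1 (toLex (c, l))
    rw [permExponent_apply, permExponent_apply]
    refine Finset.sum_congr rfl fun a _ => ?_
    rw [Prod.Lex.lt_iff] at hs
    simp only [ofLex_toLex] at hs
    rcases lt_trichotomy a i with ha | rfl | ha
    · rw [hmin a ha]; rfl
    · rw [if_neg, if_neg]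
      · rintro ⟨rfl, rfl⟩
        simp at hs
      · rintro ⟨rfl, rfl⟩
        simp only [lt_self_iff_false, true_and, false_or] at hs
        exact absurd hs (not_lt.2 (by simpa using hgt.le))
    · have := hp ha
      rw [if_neg, if_neg] <;>
      · rintro ⟨rfl, -⟩
        rcases hs with hs | hs
        · exact absurd hs this.not_gt
        · exact this.ne' hs.1
  · change permExponent hr p π (toLex (p i, Fin.castLE hr i)) <
      permExponent hr p 1 (toLex (p i, Fin.castLE hr i))
    rw [permExponent_apply, permExponent_apply, Finset.sum_eq_zero, Finset.sum_eq_single i]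
    · simp
    · intro a _ ha
      rw [if_neg]
      exact fun h => ha (hp.injective h.1)
    · simp
    · intro a _
      rw [if_neg]
      rintro ⟨h1, h2⟩
      rw [hp.injective h1] at h2
      exact hi (Fin.castLE_injective hr h2)

theorem degree_genericMinor {k r : ℕ} (hr : r ≤ k) {p : Fin r → Fin k} (hp : StrictMono p) :
    MonomialOrder.lex.degree (genericMinor hr p) = permExponent hr p 1 ∧
      MonomialOrder.lex.Monic (genericMinor hr p) := by
  classical
  have hcoeff : coeff (permExponent hr p 1) (genericMinor hr p) = 1 := by
    rw [genericMinor_eq_sum, coeff_sum, Finset.sum_eq_single 1]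
    · simp
    · intro π _ hπ
      rw [coeff_monomial, if_neg]
      intro h
      have := permExponent_lt hr hp hπ
      rw [h] at this
      exact this.false
    · simp
  have hdeg : MonomialOrder.lex.degree (genericMinor hr p) = permExponent hr p 1 := by
    refine MonomialOrder.lex.toSyn.injective (le_antisymm ?_ ?_)
    · rw [MonomialOrder.degree_le_iff]
      intro d hd
      rw [genericMinor_eq_sum, mem_support_iff, coeff_sum] at hd
      obtain ⟨π, _, hπ⟩ := Finset.exists_ne_zero_of_sum_ne_zero hd
      rw [coeff_monomial] at hπ
      rw [← (ite_ne_right_iff.1 hπ).1]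
      by_cases h1 : π = 1
      · rw [h1]
      · exact (permExponent_lt hr hp h1).le
    · exact MonomialOrder.lex.le_degree (by rw [mem_support_iff, hcoeff]; exact one_ne_zero)
  refine ⟨hdeg, ?_⟩
  rw [MonomialOrder.Monic, MonomialOrder.leadingCoeff, hdeg, hcoeff]

theorem evalMat_genericMinor {k r : ℕ} (hr : r ≤ k) (p : Fin r → Fin k)
    (z : Matrix (Fin k) (Fin k) ℂ) :
    evalMat z (genericMinor hr p) = (z.submatrix (Fin.castLE hr) p).det := by
  rw [genericMinor, AlgHom.map_det]
  congr 1
  ext a b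
  simp [evalMat]

theorem rowInvariant_genericMinor {k r : ℕ} (hr : r ≤ k) (p : Fin r → Fin k) :
    RowInvariant (genericMinor hr p) := by
  intro x y hxy t z
  rw [evalMat_genericMinor, evalMat_genericMinor]
  by_cases hy : (y : ℕ) < r
  · have hx : (x : ℕ) < r := lt_trans hxy hy
    rw [← Matrix.det_updateRow_add_smul_self (z.submatrix (Fin.castLE hr) p)
      (i := ⟨y, hy⟩) (j := ⟨x, hx⟩) (by simpa [Fin.ext_iff] using (Fin.lt_def.1 hxy).ne') t]
    congr 1
    ext a b
    by_cases ha : a = ⟨y, hy⟩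
    · subst ha
      simp [Matrix.updateRow_apply]
    · have : Fin.castLE hr a ≠ y := fun h => ha (Fin.ext (by simpa using congrArg Fin.val h))
      simp [Matrix.updateRow_apply, ha, this]
  · congr 1
    ext a b
    have : Fin.castLE hr a ≠ y := fun h => hy (by rw [← h]; exact a.2)
    simp [Matrix.updateRow_apply, this]

theorem flagMinorEval_image {k r : ℕ} (hr : r ≤ k) {p : Fin r → Fin k} (hp : StrictMono p)
    (z : Matrix (Fin k) (Fin k) ℂ) :
    flagMinorEval z (Finset.univ.image p) = evalMat z (genericMinor hr p) := by
  have hcard : (Finset.univ.image p).card = r := by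
    rw [Finset.card_image_of_injective _ hp.injective, Finset.card_univ, Fintype.card_fin]
  have hp' : (fun a => p (Fin.cast hcard a)) = (Finset.univ.image p).orderEmbOfFin rfl :=
    Finset.orderEmbOfFin_unique rfl (fun a => Finset.mem_image_of_mem p (Finset.mem_univ _))
      (hp.comp (Fin.cast_strictMono hcard))
  rw [evalMat_genericMinor, flagMinorEval,
    ← Matrix.det_submatrix_equiv_self (finCongr hcard) (z.submatrix (Fin.castLE hr) p)]
  congr 1
  ext a b
  rw [Matrix.of_apply, ← hp']
  rfl

/-- The algebra generated by the nonempty flag minors of the generic matrix. -/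
noncomputable def minorAlgebra (k : ℕ) : Subalgebra ℂ (MvPolynomial (Fin k ×ₗ Fin k) ℂ) :=
  Algebra.adjoin ℂ {f | ∃ (r : ℕ) (hr : r ≤ k) (p : Fin r → Fin k),
    0 < r ∧ StrictMono p ∧ f = genericMinor hr p}

theorem rowInvariant_of_mem_minorAlgebra {k : ℕ} {f : MvPolynomial (Fin k ×ₗ Fin k) ℂ}
    (hf : f ∈ minorAlgebra k) : RowInvariant f := by
  intro x y hxy t z
  induction hf using Algebra.adjoin_induction with
  | mem f hf =>
    obtain ⟨r, hr, p, -, -, rfl⟩ := hf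
    exact rowInvariant_genericMinor hr p x y hxy t z
  | algebraMap a => simp
  | add f g _ _ hf hg => rw [map_add, map_add, hf, hg]
  | mul f g _ _ hf hg => rw [map_mul, map_mul, hf, hg]

theorem sum_permExponent_one {k r : ℕ} (hr : r ≤ k) (p : Fin r → Fin k) (S : Finset (Fin k))
    (a : Fin r) :
    ∑ c ∈ S, permExponent hr p 1 (toLex (c, Fin.castLE hr a)) = if p a ∈ S then 1 else 0 := by
  simp only [permExponent_apply]
  rw [Finset.sum_comm, Finset.sum_eq_single a]
  · simp
  · intro b _ hb
    refine Finset.sum_eq_zero fun c _ => if_neg ?_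
    rintro ⟨-, h⟩
    exact hb (Fin.castLE_injective hr h)
  · simp

theorem IsBallot.exists_diagonal {k : ℕ} {M : Fin k ×ₗ Fin k →₀ ℕ} (hM : IsBallot M)
    (hM0 : M ≠ 0) :
    ∃ (r : ℕ) (hr : r ≤ k) (p : Fin r → Fin k) (M' : Fin k ×ₗ Fin k →₀ ℕ),
      0 < r ∧ StrictMono p ∧ M = permExponent hr p 1 + M' ∧ M' < M ∧ IsBallot M' := by
  classical
  have hex : ∃ r : ℕ, ∀ i : Fin k, r ≤ i → ∀ c, M (toLex (c, i)) = 0 :=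
    ⟨k, fun i hi => absurd i.2 (not_lt.2 hi)⟩
  obtain ⟨r, hrz, hrmin⟩ : ∃ r : ℕ, (∀ i : Fin k, r ≤ i → ∀ c, M (toLex (c, i)) = 0) ∧
      ∀ r' < r, ¬ ∀ i : Fin k, r' ≤ i → ∀ c, M (toLex (c, i)) = 0 :=
    ⟨Nat.find hex, Nat.find_spec hex, fun r' => Nat.find_min hex⟩
  have hr : r ≤ k := by
    by_contra! h
    exact hrmin k h fun i hi => absurd i.2 (not_lt.2 hi)
  have hr0 : 0 < r := by
    rcases Nat.eq_zero_or_pos r with rfl | h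
    · refine absurd (Finsupp.ext fun s => ?_) hM0
      exact hrz (ofLex s).2 (Nat.zero_le _) (ofLex s).1
    · exact h
  have hprev : ∀ x y j : Fin k, x < y → M (toLex (j, y)) ≠ 0 → ∃ c < j, M (toLex (c, x)) ≠ 0 := by
    intro x y j hxy hj
    by_contra! h
    have h1 := hM x y hxy j
    rw [Finset.sum_eq_zero (s := Finset.Iio j) fun c hc => h c (Finset.mem_Iio.1 hc)] at h1
    have h2 := Finset.single_le_sum (f := fun c => M (toLex (c, y))) (fun _ _ => Nat.zero_le _)
      (Finset.mem_Iic.2 (le_refl j))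
    exact hj (Nat.le_zero.1 (h2.trans h1))
  have hne : ∀ a : Fin r, ∃ c, M (toLex (c, Fin.castLE hr a)) ≠ 0 := by
    intro a
    have := hrmin (r - 1) (by omega)
    push Not at this
    obtain ⟨i, hi, c, hc⟩ := this
    rcases (show a.1 ≤ i.1 by omega).eq_or_lt with h | h
    · exact ⟨c, by rwa [show Fin.castLE hr a = i from Fin.ext h]⟩
    · obtain ⟨c', -, hc'⟩ := hprev (Fin.castLE hr a) i c h hc
      exact ⟨c', hc'⟩
  have hmin : ∀ a : Fin r, ∃ c, M (toLex (c, Fin.castLE hr a)) ≠ 0 ∧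
      ∀ c' < c, M (toLex (c', Fin.castLE hr a)) = 0 := by
    intro a
    obtain ⟨c, hc, hlt⟩ := WellFounded.has_min (wellFounded_lt (α := Fin k))
      {c | M (toLex (c, Fin.castLE hr a)) ≠ 0} (hne a)
    exact ⟨c, hc, fun c' hc' => by_contra fun h => hlt c' h hc'⟩
  choose p hp hpmin using hmin
  have hmono : StrictMono p := by
    intro a b hab
    obtain ⟨c, hc, hc'⟩ := hprev (Fin.castLE hr a) (Fin.castLE hr b) (p b) (by simpa using hab)
      (hp b)
    refine lt_of_le_of_lt (le_of_not_gt fun h => hc' (hpmin a c h)) hc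
  have hle : permExponent hr p 1 ≤ M := by
    intro s
    induction s using Lex.rec with | h s => ?_
    obtain ⟨c, i⟩ := s
    by_cases hi : (i : ℕ) < r
    · have := sum_permExponent_one hr p {c} ⟨i, hi⟩
      rw [Finset.sum_singleton, Fin.castLE_mk] at this
      rw [this]
      split_ifs with h
      · rw [Finset.mem_singleton] at h
        have := hp ⟨i, hi⟩
        rw [h] at this
        exact Nat.one_le_iff_ne_zero.2 this
      · exact Nat.zero_le _
    · rw [permExponent_apply, Finset.sum_eq_zero]
      · exact Nat.zero_le _
      · intro a _
        refine if_neg fun h => hi ?_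
        rw [← h.2]
        exact (((1 : Equiv.Perm (Fin r)) a)).2
  have hsub : M = permExponent hr p 1 + (M - permExponent hr p 1) :=
    (add_tsub_cancel_of_le hle).symm
  refine ⟨r, hr, p, M - permExponent hr p 1, hr0, hmono, hsub, ?_, ?_⟩
  · refine lt_of_le_of_ne tsub_le_self fun h => ?_
    have h1 := sum_permExponent_one hr p {p ⟨0, hr0⟩} ⟨0, hr0⟩
    rw [h, right_eq_add] at hsub
    rw [hsub] at h1
    simp at h1
  · intro x y hxy j
    by_cases hy : (y : ℕ) < r
    · have hx : (x : ℕ) < r := lt_trans hxy hy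
      have hsplit : ∀ (i : Fin k) (S : Finset (Fin k)), ∑ c ∈ S, M (toLex (c, i)) =
          ∑ c ∈ S, permExponent hr p 1 (toLex (c, i)) +
          ∑ c ∈ S, (M - permExponent hr p 1) (toLex (c, i)) := by
        intro i S
        rw [← Finset.sum_add_distrib]
        refine Finset.sum_congr rfl fun c _ => ?_
        rw [← Finsupp.add_apply, ← hsub]
      have hA := hsplit y (Finset.Iic j)
      have hB := hsplit x (Finset.Iio j)
      have hAB := hM x y hxy j
      have hdA : ∑ c ∈ Finset.Iic j, permExponent hr p 1 (toLex (c, y)) = _ :=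
        sum_permExponent_one hr p (Finset.Iic j) ⟨y, hy⟩
      have hdB : ∑ c ∈ Finset.Iio j, permExponent hr p 1 (toLex (c, x)) = _ :=
        sum_permExponent_one hr p (Finset.Iio j) ⟨x, hx⟩
      by_cases hj : p ⟨y, hy⟩ ≤ j
      · rw [if_pos (Finset.mem_Iic.2 hj)] at hdA
        split_ifs at hdB <;> omega
      · have : ∑ c ∈ Finset.Iic j, M (toLex (c, y)) = 0 :=
          Finset.sum_eq_zero fun c hc =>
            hpmin ⟨y, hy⟩ c (lt_of_le_of_lt (Finset.mem_Iic.1 hc) (not_le.1 hj))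
        omega
    · rw [Finset.sum_eq_zero]
      · exact Nat.zero_le _
      · intro c _
        rw [Finsupp.tsub_apply, hrz y (not_lt.1 hy) c, Nat.zero_sub]

theorem IsBallot.exists_monic_mem_minorAlgebra {k : ℕ} {M : Fin k ×ₗ Fin k →₀ ℕ}
    (hM : IsBallot M) :
    ∃ q ∈ minorAlgebra k, MonomialOrder.lex.degree q = M ∧ MonomialOrder.lex.Monic q := by
  induction M using WellFoundedLT.induction with
  | ind M ih =>
    by_cases hM0 : M = 0
    · exact ⟨1, one_mem _, by rw [hM0, MonomialOrder.degree_one], MonomialOrder.monic_one⟩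
    obtain ⟨r, hr, p, M', hr0, hp, hadd, hlt, hM'⟩ := hM.exists_diagonal hM0
    obtain ⟨q, hq, hdeg, hmonic⟩ := ih M' hlt hM'
    obtain ⟨hdeg', hmonic'⟩ := degree_genericMinor hr hp
    refine ⟨genericMinor hr p * q, mul_mem (Algebra.subset_adjoin ⟨r, hr, p, hr0, hp, rfl⟩) hq,
      ?_, hmonic'.mul hmonic⟩
    rw [MonomialOrder.degree_mul hmonic'.ne_zero hmonic.ne_zero, hdeg, hdeg', ← hadd]

theorem RowInvariant.mem_minorAlgebra {k : ℕ} {f : MvPolynomial (Fin k ×ₗ Fin k) ℂ}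
    (hf : RowInvariant f) : f ∈ minorAlgebra k := by
  induction hd : MonomialOrder.lex.toSyn (MonomialOrder.lex.degree f) using
    WellFoundedLT.induction generalizing f with
  | ind d ih =>
    by_cases hf0 : f = 0
    · rw [hf0]; exact zero_mem _
    obtain ⟨q, hq, hdeg, hmonic⟩ := (hf.isBallot_degree hf0).exists_monic_mem_minorAlgebra
    set a := MonomialOrder.lex.leadingCoeff f with ha
    have hmem : f - a • q ∈ minorAlgebra k := by
      by_cases h0 : f - a • q = 0
      · rw [h0]; exact zero_mem _
      refine ih _ ?_ (fun x y hxy t z => ?_) rfl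
      · rw [← hd]
        refine lt_of_le_of_ne ?_ fun h => ?_
        · refine MonomialOrder.degree_sub_le.trans (sup_le le_rfl ?_)
          exact MonomialOrder.degree_smul_le.trans (by rw [hdeg])
        · have h := MonomialOrder.lex.toSyn.injective h
          refine MonomialOrder.coeff_degree_ne_zero_iff (m := MonomialOrder.lex) |>.2 h0 ?_
          rw [h, coeff_sub, coeff_smul]
          nth_rw 2 [← hdeg]
          rw [hmonic.coeff_degree, ha, MonomialOrder.leadingCoeff, smul_eq_mul, mul_one, sub_self]
      · rw [map_sub, map_sub, hf x y hxy t z, map_smul, map_smul,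
          rowInvariant_of_mem_minorAlgebra hq x y hxy t z]
    have := add_mem hmem (Subalgebra.smul_mem _ hq a)
    rwa [sub_add_cancel] at this

theorem transvection_mul_eq_updateRow {k : ℕ} (x y : Fin k) (t : ℂ)
    (z : Matrix (Fin k) (Fin k) ℂ) :
    Matrix.transvection y x t * z = z.updateRow y (z y + t • z x) := by
  ext r c
  by_cases hr : r = y
  · subst hr
    simp
  · simp [hr]

theorem det_updateRow_inv_det_smul {k : ℕ} (l : Fin k) {z : Matrix (Fin k) (Fin k) ℂ}
    (hz : z.det ≠ 0) : (z.updateRow l (z.det⁻¹ • z l)).det = 1 := by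
  rw [Matrix.det_updateRow_smul, Matrix.updateRow_eq_self, inv_mul_cancel₀ hz]

/-- Dividing row `l` by the determinant retracts the invertible matrices to those of determinant `1`;
pulling a polynomial back along this map gives a polynomial up to a power of the determinant. -/
theorem exists_detHomogenization {k : ℕ} (l : Fin k) (f : MvPolynomial (Fin k ×ₗ Fin k) ℂ) :
    ∃ (N : ℕ) (g : MvPolynomial (Fin k ×ₗ Fin k) ℂ),
      ∀ z : Matrix (Fin k) (Fin k) ℂ, z.det ≠ 0 →
        evalMat z g = z.det ^ N * evalMat (z.updateRow l (z.det⁻¹ • z l)) f := by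
  classical
  have hdet : ∀ z : Matrix (Fin k) (Fin k) ℂ, evalMat z (genericMinor le_rfl id) = z.det :=
    fun z => evalMat_genericMinor le_rfl id z
  refine ⟨f.totalDegree, ∑ e ∈ f.support,
    monomial e (coeff e f) * genericMinor le_rfl id ^ (f.totalDegree - ∑ c, e (toLex (c, l))),
    fun z hz => ?_⟩
  rw [evalMat_eq_sum (z.updateRow l (z.det⁻¹ • z l)), map_sum, Finset.mul_sum]
  refine Finset.sum_congr rfl fun e he => ?_
  have hle : ∑ c, e (toLex (c, l)) ≤ f.totalDegree := by
    refine le_trans ?_ (le_totalDegree he)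
    rw [Finsupp.sum_fintype _ _ (fun _ => rfl), ← Equiv.sum_comp toLex, Fintype.sum_prod_type]
    exact Finset.sum_le_sum fun c _ =>
      Finset.single_le_sum (f := fun i => e (toLex (c, i))) (fun _ _ => Nat.zero_le _)
        (Finset.mem_univ l)
  have hprod : ∏ s, (z.updateRow l (z.det⁻¹ • z l)) (ofLex s).2 (ofLex s).1 ^ e s =
      (∏ s, z (ofLex s).2 (ofLex s).1 ^ e s) * (z.det⁻¹) ^ ∑ c, e (toLex (c, l)) := by
    rw [← Finset.prod_pow_eq_pow_sum, ← prod_lex_row_pow l (fun _ => z.det⁻¹),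
      ← Finset.prod_mul_distrib]
    refine Finset.prod_congr rfl fun s _ => ?_
    rw [← mul_pow]
    congr 1
    by_cases hs : (ofLex s).2 = l
    · simp [hs, mul_comm]
    · simp [hs]
  rw [map_mul, map_pow, hdet, hprod, pow_sub₀ _ hz hle, inv_pow]
  simp only [evalMat, aeval_monomial, Algebra.algebraMap_self_apply]
  rw [Finsupp.prod_fintype _ _ (by simp)]
  ring

theorem genericMinor_id_ne_zero (k : ℕ) : genericMinor (le_refl k) id ≠ 0 := by
  intro h
  have := evalMat_genericMinor (le_refl k) id (1 : Matrix (Fin k) (Fin k) ℂ)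
  rw [h, map_zero] at this
  exact zero_ne_one (this.trans Matrix.det_one)

theorem rowInvariant_of_det_ne_zero {k : ℕ} {f : MvPolynomial (Fin k ×ₗ Fin k) ℂ}
    (hf : ∀ x y : Fin k, x < y → ∀ (t : ℂ) (z : Matrix (Fin k) (Fin k) ℂ), z.det ≠ 0 →
      evalMat (z.updateRow y (z y + t • z x)) f = evalMat z f) : RowInvariant f := by
  classical
  intro x y hxy t z
  set ρ : MvPolynomial (Fin k ×ₗ Fin k) ℂ →ₐ[ℂ] MvPolynomial (Fin k ×ₗ Fin k) ℂ :=
    aeval fun s => X s + if (ofLex s).2 = y then C t * X (toLex ((ofLex s).1, x)) else 0 with hρ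
  have heval : ∀ w g, evalMat w (ρ g) = evalMat (w.updateRow y (w y + t • w x)) g := by
    intro w g
    rw [hρ, evalMat, ← AlgHom.comp_apply, comp_aeval, evalMat]
    congr 2
    funext s
    by_cases hs : (ofLex s).2 = y
    · simp [hs]
    · simp [hs]
  have hzero : (ρ f - f) * genericMinor (le_refl k) id = 0 := by
    refine evalMat_funext fun w => ?_
    rw [map_mul, map_sub, heval, map_zero, evalMat_genericMinor]
    by_cases hw : w.det = 0
    · exact mul_eq_zero_of_right _ hw
    · rw [hf x y hxy t w hw, sub_self, zero_mul]
  have := (mul_eq_zero.1 hzero).resolve_right (genericMinor_id_ne_zero k)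
  rw [← heval, sub_eq_zero.1 this]

theorem exists_eval_flagMinorEval_of_mem_minorAlgebra {k : ℕ}
    {f : MvPolynomial (Fin k ×ₗ Fin k) ℂ} (hf : f ∈ minorAlgebra k) :
    ∃ g : MvPolynomial {J : Finset (Fin k) // J.Nonempty ∧ J ≠ Finset.univ} ℂ,
      ∀ z : Matrix (Fin k) (Fin k) ℂ, z.det = 1 →
        evalMat z f = eval (fun J => flagMinorEval z J.1) g := by
  induction hf using Algebra.adjoin_induction with
  | mem f hf =>
    obtain ⟨r, hr, p, hr0, hp, rfl⟩ := hf
    rcases hr.eq_or_lt with rfl | hlt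
    · refine ⟨1, fun z hz => ?_⟩
      have hid : p = id := by
        funext a
        exact DFunLike.congr_fun
          (Subsingleton.elim (hp.orderIsoOfSurjective p (Finite.surjective_of_injective
            hp.injective)) (OrderIso.refl _)) a
      rw [evalMat_genericMinor, map_one, ← hz, hid]
      rfl
    · refine ⟨X ⟨Finset.univ.image p, ?_, fun h => ?_⟩, fun z _ => ?_⟩
      · exact ⟨p ⟨0, hr0⟩, Finset.mem_image_of_mem p (Finset.mem_univ _)⟩
      · have := congrArg Finset.card h
        rw [Finset.card_image_of_injective _ hp.injective, Finset.card_univ, Finset.card_univ,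
          Fintype.card_fin, Fintype.card_fin] at this
        exact hlt.ne this
      · rw [eval_X, flagMinorEval_image hr hp]
  | algebraMap a => exact ⟨C a, fun z _ => by simp⟩
  | add f g _ _ hf hg =>
    obtain ⟨f', hf'⟩ := hf
    obtain ⟨g', hg'⟩ := hg
    exact ⟨f' + g', fun z hz => by rw [map_add, map_add, hf' z hz, hg' z hz]⟩
  | mul f g _ _ hf hg =>
    obtain ⟨f', hf'⟩ := hf
    obtain ⟨g', hg'⟩ := hg
    exact ⟨f' * g', fun z hz => by rw [map_mul, map_mul, hf' z hz, hg' z hz]⟩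

/-- Theorem 6.5.1: the ring of `U`-invariant regular functions `ℂ[SL_k]^U` is generated
by the `2^k − 2` flag minors `P_J`, `J` a nonempty proper subset of `{1,…,k}`.  Stated
concretely: any polynomial function `f` on `k×k` matrices that is invariant under left
multiplication by lower-triangular unipotent matrices (on `SL_k(ℂ)`) is, on `SL_k(ℂ)`,
a polynomial in the flag minors. -/
theorem flag_minors_generate_invariants (k : ℕ) (hk : 2 ≤ k)
    (f : Matrix (Fin k) (Fin k) ℂ → ℂ)
    (hpoly : ∃ F : MvPolynomial (Fin k × Fin k) ℂ,
      ∀ z : Matrix (Fin k) (Fin k) ℂ, f z = eval (fun q => z q.1 q.2) F)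
    (hinv : ∀ u z : Matrix (Fin k) (Fin k) ℂ,
      (∀ i, u i i = 1) → (∀ i j, i < j → u i j = 0) → z.det = 1 → f (u * z) = f z) :
    ∃ g : MvPolynomial {J : Finset (Fin k) // J.Nonempty ∧ J ≠ Finset.univ} ℂ,
      ∀ z : Matrix (Fin k) (Fin k) ℂ, z.det = 1 →
        f z = eval (fun J => flagMinorEval z J.1) g := by
  obtain ⟨F, hF⟩ := hpoly
  set l : Fin k := ⟨k - 1, by omega⟩ with hl
  set F' : MvPolynomial (Fin k ×ₗ Fin k) ℂ := rename (fun q => toLex (q.2, q.1)) F with hF'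
  have hfF : ∀ z, f z = evalMat z F' := by
    intro z
    rw [hF, hF', evalMat, aeval_rename, aeval_eq_eval]
    rfl
  have hrow : ∀ x y : Fin k, x < y → ∀ (t : ℂ) (z : Matrix (Fin k) (Fin k) ℂ), z.det = 1 →
      evalMat (z.updateRow y (z y + t • z x)) F' = evalMat z F' := by
    intro x y hxy t z hz
    rw [← hfF, ← hfF, ← transvection_mul_eq_updateRow]
    refine hinv _ _ (fun i => ?_) (fun i j hij => ?_) hz
    · rw [Matrix.transvection, Matrix.add_apply, Matrix.one_apply_eq, Matrix.single_apply_of_ne,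
        add_zero]
      rintro ⟨rfl, rfl⟩
      exact hxy.false
    · rw [Matrix.transvection, Matrix.add_apply, Matrix.one_apply_ne hij.ne,
        Matrix.single_apply_of_ne, add_zero]
      rintro ⟨rfl, rfl⟩
      exact hxy.not_gt hij
  obtain ⟨N, G, hG⟩ := exists_detHomogenization l F'
  have hGinv : RowInvariant G := by
    refine rowInvariant_of_det_ne_zero fun x y hxy t z hz => ?_
    have hxl : x ≠ l := by
      rintro rfl
      have := Fin.lt_def.1 hxy
      simp only [hl] at this
      omega
    have hdet : (z.updateRow y (z y + t • z x)).det = z.det :=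
      Matrix.det_updateRow_add_smul_self z hxy.ne' t
    rw [hG z hz, hG _ (hdet ▸ hz), hdet]
    congr 1
    rw [← hrow x y hxy (if y = l then z.det⁻¹ * t else t) _ (det_updateRow_inv_det_smul l hz)]
    congr 2
    ext r c
    by_cases hyl : y = l
    · by_cases hr : r = l
      · subst hr; simp [hyl, hxl]; ring
      · simp [hyl, hr]
    · by_cases hr : r = l
      · subst hr; simp [hyl, Ne.symm hyl]
      · by_cases hry : r = y
        · subst hry; simp [hr, hxl]
        · simp [hr, hry]
  obtain ⟨g, hg⟩ := exists_eval_flagMinorEval_of_mem_minorAlgebra hGinv.mem_minorAlgebra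
  refine ⟨g, fun z hz => ?_⟩
  rw [← hg z hz, hG z (by rw [hz]; exact one_ne_zero), hz, hfF]
  simp
end

section
/- Let 1 ≤ a ≤ b. The Plücker ring R_{a,b}, i.e., the ℂ-subalgebra of the polynomial ring in the entries of a generic a×b matrix consisting of all polynomials f satisfying f(g·z) = f(z) for every g ∈ SL_a(ℂ) and every a×b complex matrix z, is a unique factorization domain. -/
open MvPolynomial

/-- The Plücker ring `R_{a,b} = ℂ[Mat_{a×b}]^{SL_a}`: the subalgebra of the polynomial
ring in the entries of a generic `a × b` matrix consisting of all polynomials `f` with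
`f(g·z) = f(z)` for every `g ∈ SL_a(ℂ)` and every `a × b` complex matrix `z`. -/
noncomputable def pluckerRing (a b : ℕ) :
    Subalgebra ℂ (MvPolynomial (Fin a × Fin b) ℂ) where
  carrier := { f | ∀ g : Matrix (Fin a) (Fin a) ℂ, g.det = 1 →
    ∀ z : Matrix (Fin a) (Fin b) ℂ,
      eval (fun q => (g * z) q.1 q.2) f = eval (fun q => z q.1 q.2) f }
  mul_mem' := by
    intro x y hx hy g hg z
    simp only [map_mul, hx g hg z, hy g hg z]
  add_mem' := by
    intro x y hx hy g hg z
    simp only [map_add, hx g hg z, hy g hg z]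
  algebraMap_mem' := by
    intro r g hg z
    simp

section FactoriallyClosed

variable {R A : Type*} [CommRing R] [CommRing A] [IsDomain A] [Algebra R A]

/-- A prime of `A` lying in a factorially closed subalgebra is prime in that subalgebra. -/
lemma Subalgebra.prime_mk_of_factoriallyClosed (S : Subalgebra R A)
    (hS : ∀ x y : A, x * y ∈ S → x * y ≠ 0 → x ∈ S) {p : A} (hpS : p ∈ S) (hp : Prime p) :
    Prime (⟨p, hpS⟩ : S) := by
  have hdvd : ∀ x : S, p ∣ (x : A) → (⟨p, hpS⟩ : S) ∣ x := by
    rintro ⟨x, hx⟩ ⟨c, rfl : x = p * c⟩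
    rcases eq_or_ne (p * c) 0 with h | h
    · exact ⟨0, Subtype.ext (by simpa using h)⟩
    · exact ⟨⟨c, hS c p (by rwa [mul_comm]) (by rwa [mul_comm])⟩, rfl⟩
  refine ⟨fun h => hp.ne_zero (congrArg Subtype.val h),
    fun h => hp.not_isUnit (h.map S.val), fun x y h => ?_⟩
  exact (hp.dvd_or_dvd (map_dvd S.val h)).imp (hdvd x) (hdvd y)

/-- A factorially closed subalgebra of a unique factorization domain is a unique
factorization domain. -/
theorem Subalgebra.uniqueFactorizationMonoid_of_factoriallyClosed
    [UniqueFactorizationMonoid A] (S : Subalgebra R A)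
    (hS : ∀ x y : A, x * y ∈ S → x * y ≠ 0 → x ∈ S) : UniqueFactorizationMonoid S := by
  refine UniqueFactorizationMonoid.of_exists_prime_factors fun ⟨a, ha⟩ ha0 => ?_
  have ha0' : a ≠ 0 := fun h => ha0 (Subtype.ext h)
  clear ha0
  induction a using UniqueFactorizationMonoid.induction_on_prime with
  | h₁ => exact absurd rfl ha0'
  | h₂ u hu =>
    refine ⟨0, by simp, ?_⟩
    obtain ⟨v, huv⟩ := hu.exists_right_inv
    have hv : v ∈ S := hS v u (by rw [mul_comm, huv]; exact S.one_mem) (by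
      rw [mul_comm, huv]; exact one_ne_zero)
    rw [Multiset.prod_zero]
    exact (associated_one_iff_isUnit.2 (IsUnit.of_mul_eq_one (⟨v, hv⟩ : S)
      (Subtype.ext huv))).symm
  | h₃ x p hx hp ih =>
    have hpS : p ∈ S := hS p x ha ha0'
    have hxS : x ∈ S := hS x p (by rwa [mul_comm]) (by rwa [mul_comm])
    obtain ⟨f, hf, hfx⟩ := ih hxS hx
    refine ⟨(⟨p, hpS⟩ : S) ::ₘ f, ?_, ?_⟩
    · intro q hq
      rcases Multiset.mem_cons.1 hq with rfl | hq
      · exact S.prime_mk_of_factoriallyClosed hS hpS hp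
      · exact hf q hq
    · rw [Multiset.prod_cons]
      exact hfx.mul_left _

end FactoriallyClosed

section Transvections

open Matrix

variable {n K : Type*} [Fintype n] [DecidableEq n] [Field K]

lemma Submonoid.diagonal_mulSingle_mul_mem_of_transvection_mem (S : Submonoid (Matrix n n K))
    (hS : ∀ i j : n, i ≠ j → ∀ c : K, transvection i j c ∈ S) {i k : n} (hik : i ≠ k)
    {c : K} (hc : c ≠ 0) :
    diagonal (Pi.mulSingle i c * Pi.mulSingle k c⁻¹ : n → K) ∈ S := by
  have key : diagonal (Pi.mulSingle i c * Pi.mulSingle k c⁻¹ : n → K) =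
      transvection i k c * (transvection k i (-c⁻¹) * (transvection i k c *
        (transvection i k (-1) * (transvection k i 1 * (transvection i k (-1) *
          (1 : Matrix n n K)))))) := by
    ext r s
    have hki := hik.symm
    by_cases hri : r = i
    · subst hri
      simp only [transvection_mul_apply_same, transvection_mul_apply_of_ne, hik, hki, ne_eq,
        not_false_eq_true, diagonal_apply, one_apply, Pi.mul_apply, Pi.mulSingle_apply]
      split_ifs <;> simp_all
    · by_cases hrk : r = k
      · subst hrk
        simp only [transvection_mul_apply_same, transvection_mul_apply_of_ne, hik, hki, ne_eq,
          not_false_eq_true, diagonal_apply, one_apply, Pi.mul_apply, Pi.mulSingle_apply]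
        split_ifs <;> simp_all
      · simp only [transvection_mul_apply_of_ne, hri, hrk, ne_eq, not_false_eq_true,
          diagonal_apply, one_apply, Pi.mul_apply, Pi.mulSingle_apply]
        simp
  rw [key]
  have h₁ := hS i k hik
  have h₂ := hS k i hik.symm
  exact mul_mem (h₁ _) (mul_mem (h₂ _) (mul_mem (h₁ _) (mul_mem (h₁ _) (mul_mem (h₂ _)
    (mul_mem (h₁ _) S.one_mem)))))

lemma Submonoid.diagonal_mem_of_transvection_mem (S : Submonoid (Matrix n n K))
    (hS : ∀ i j : n, i ≠ j → ∀ c : K, transvection i j c ∈ S) (d : n → K)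
    (hd : ∏ i, d i = 1) : diagonal d ∈ S := by
  have hd0 : ∀ i, d i ≠ 0 := fun i =>
    Finset.prod_ne_zero_iff.1 (hd.trans_ne one_ne_zero) i (Finset.mem_univ i)
  cases isEmpty_or_nonempty n with
  | inl _ => rw [Subsingleton.elim (diagonal d) 1]; exact S.one_mem
  | inr hn =>
    obtain ⟨k⟩ := hn
    have hprod : diagonal d =
        diagonal (∏ i ∈ Finset.univ.erase k, (Pi.mulSingle i (d i) *
          Pi.mulSingle k (d i)⁻¹ : n → K)) := by
      congr 1
      ext j
      rw [Finset.prod_apply]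
      simp only [Pi.mul_apply, Finset.prod_mul_distrib]
      by_cases hj : j = k
      · subst hj
        rw [← Finset.mul_prod_erase _ _ (Finset.mem_univ j)] at hd
        rw [Finset.prod_eq_one]
        · simp [Finset.prod_inv_distrib, eq_inv_of_mul_eq_one_left hd]
        · intro i hi
          rw [Pi.mulSingle_eq_of_ne (Finset.ne_of_mem_erase hi).symm]
      · simp [Pi.mulSingle_apply, hj]
    have hmem : ∀ s : Finset n, k ∉ s →
        diagonal (∏ i ∈ s, (Pi.mulSingle i (d i) * Pi.mulSingle k (d i)⁻¹ : n → K)) ∈ S := by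
      intro s
      induction s using Finset.induction_on with
      | empty => simp
      | insert i s his ih =>
        intro hk
        rw [Finset.mem_insert, not_or] at hk
        rw [Finset.prod_insert his]
        have := mul_mem (S.diagonal_mulSingle_mul_mem_of_transvection_mem hS (Ne.symm hk.1)
          (hd0 i)) (ih hk.2)
        rwa [diagonal_mul_diagonal'] at this
    rw [hprod]
    exact hmem _ (Finset.notMem_erase k _)

/-- Over a field, transvections generate the matrices of determinant one. -/
theorem Submonoid.mem_of_det_eq_one_of_transvection_mem (S : Submonoid (Matrix n n K))
    (hS : ∀ i j : n, i ≠ j → ∀ c : K, transvection i j c ∈ S) (g : Matrix n n K)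
    (hg : g.det = 1) : g ∈ S := by
  refine diagonal_transvection_induction (· ∈ S) g (fun D hD => ?_)
    (fun t => hS t.i t.j t.hij t.c) fun _ _ => mul_mem
  exact S.diagonal_mem_of_transvection_mem hS D (by rw [← det_diagonal, hD, hg])

end Transvections

section RowAddition

open Matrix

variable {m n K : Type*} [Fintype m] [DecidableEq m] [Field K]

/-- The substitution adding `t` times row `j` to row `i` of the generic matrix, with values
in polynomials in `t`. -/
noncomputable def MvPolynomial.rowAddHom (n K : Type*) [Field K] (i j : m) :
    MvPolynomial (m × n) K →ₐ[K] Polynomial (MvPolynomial (m × n) K) :=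
  aeval fun q => Polynomial.C (X q) +
    if q.1 = i then Polynomial.X * Polynomial.C (X (j, q.2)) else 0

lemma MvPolynomial.eval_eval_rowAddHom (i j : m) (t : K) (z : Matrix m n K)
    (f : MvPolynomial (m × n) K) :
    eval (fun q => z q.1 q.2) ((rowAddHom n K i j f).eval (C t)) =
      eval (fun q => (transvection i j t * z) q.1 q.2) f := by
  induction f using MvPolynomial.induction_on with
  | C a =>
    rw [← algebraMap_eq, AlgHom.commutes, Polynomial.algebraMap_apply, Polynomial.eval_C]
    simp
  | add p q hp hq => simp only [map_add, Polynomial.eval_add, hp, hq]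
  | mul_X p q hp =>
    simp only [map_mul, Polynomial.eval_mul, hp, eval_X]
    congr 1
    obtain ⟨r, s⟩ := q
    by_cases hr : r = i
    · subst hr
      simp [rowAddHom, mul_comm t]
    · simp [rowAddHom, hr]

/-- Invariance under adding multiples of row `j` to row `i` is a condition on coefficients. -/
lemma MvPolynomial.rowAddHom_eq_C_iff [Infinite K] (i j : m) (f : MvPolynomial (m × n) K) :
    rowAddHom n K i j f = Polynomial.C f ↔ ∀ (t : K) (z : Matrix m n K),
      eval (fun q => (transvection i j t * z) q.1 q.2) f = eval (fun q => z q.1 q.2) f := by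
  constructor
  · intro h t z
    rw [← eval_eval_rowAddHom, h, Polynomial.eval_C]
  · intro h
    refine Polynomial.eq_of_infinite_eval_eq _ _
      ((Set.infinite_range_of_injective (C_injective (m × n) K)).mono ?_)
    rintro _ ⟨t, rfl⟩
    refine MvPolynomial.funext fun z => ?_
    rw [Polynomial.eval_C]
    exact (eval_eval_rowAddHom i j t (Matrix.of fun r s => z (r, s)) f).trans (h t (Matrix.of fun r s => z (r, s)))

lemma MvPolynomial.rowAddHom_eq_C_of_mul [Infinite K] (i j : m) {f h : MvPolynomial (m × n) K}
    (hfh : rowAddHom n K i j (f * h) = Polynomial.C (f * h)) (h0 : f * h ≠ 0) :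
    rowAddHom n K i j f = Polynomial.C f := by
  have hmul : rowAddHom n K i j f * rowAddHom n K i j h ≠ 0 := by
    rw [← map_mul, hfh]
    exact Polynomial.C_ne_zero.2 h0
  have hdeg := congrArg Polynomial.natDegree hfh
  rw [map_mul, Polynomial.natDegree_C, Polynomial.natDegree_mul (left_ne_zero_of_mul hmul)
    (right_ne_zero_of_mul hmul)] at hdeg
  have hC := Polynomial.eq_C_of_natDegree_eq_zero (Nat.eq_zero_of_add_eq_zero_right hdeg)
  rw [hC]
  congr 1
  refine MvPolynomial.funext fun z => ?_
  have := eval_eval_rowAddHom i j 0 (Matrix.of fun r s => z (r, s)) f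
  rw [hC, Polynomial.eval_C, transvection_zero, Matrix.one_mul] at this
  exact this

end RowAddition

/-- The Plücker ring is cut out by invariance under transvections. -/
lemma mem_pluckerRing_iff_rowAddHom (a b : ℕ) (f : MvPolynomial (Fin a × Fin b) ℂ) :
    f ∈ pluckerRing a b ↔
      ∀ i j : Fin a, i ≠ j → rowAddHom (Fin b) ℂ i j f = Polynomial.C f := by
  constructor
  · intro hf i j hij
    exact (rowAddHom_eq_C_iff i j f).2 fun t z =>
      hf _ (Matrix.det_transvection_of_ne i j hij t) z
  · intro hf g hg
    let S : Submonoid (Matrix (Fin a) (Fin a) ℂ) :=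
      { carrier := {g | ∀ z : Matrix (Fin a) (Fin b) ℂ,
          eval (fun q => (g * z) q.1 q.2) f = eval (fun q => z q.1 q.2) f}
        one_mem' := fun z => by rw [Matrix.one_mul]
        mul_mem' := fun {g h} hg hh z => by rw [Matrix.mul_assoc, hg, hh] }
    exact S.mem_of_det_eq_one_of_transvection_mem
      (fun i j hij => (rowAddHom_eq_C_iff i j f).1 (hf i j hij)) g hg

/-- Corollary to Theorem 6.7.3: the Plücker ring `R_{a,b}` is a unique factorization
domain. -/
theorem pluckerRing_ufd (a b : ℕ) (ha : 1 ≤ a) (hab : a ≤ b) :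
    UniqueFactorizationMonoid (pluckerRing a b) := by
  refine (pluckerRing a b).uniqueFactorizationMonoid_of_factoriallyClosed fun f h hfh h0 => ?_
  rw [mem_pluckerRing_iff_rowAddHom] at hfh ⊢
  exact fun i j hij => rowAddHom_eq_C_of_mul i j (hfh i j hij) h0
end

section
/- Let k ≥ 2. The quotient of the polynomial ring ℂ[x_{ij} : 1 ≤ i,j ≤ k] by the principal ideal generated by det(X) − 1, where X = (x_{ij}) is the k×k matrix of indeterminates, is a unique factorization domain. That is, the coordinate ring ℂ[SL_k] is factorial. -/
open MvPolynomial

/-- The determinant of the generic `k × k` matrix of indeterminates, as a polynomial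
in the `k²` variables `x_{ij}`. -/
noncomputable def genericDet (k : ℕ) : MvPolynomial (Fin k × Fin k) ℂ :=
  Matrix.det (Matrix.of fun i j : Fin k => X (i, j))

/-- The coordinate ring `ℂ[SL_k]`, i.e. the quotient of the polynomial ring in the
`k²` entries of a generic `k × k` matrix by the ideal generated by `det(X) − 1`. -/
abbrev coordSL (k : ℕ) : Type :=
  MvPolynomial (Fin k × Fin k) ℂ ⧸ Ideal.span {genericDet k - 1}

namespace Polynomial

/-- Over a domain, a divisor of a nonzero monomial is a monomial. -/
theorem exists_eq_C_mul_X_pow_of_mul_eq {A : Type*} [CommRing A] [IsDomain A] {p q : A[X]} {a : A}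
    {n : ℕ} (ha : a ≠ 0) (h : p * q = C a * X ^ n) : ∃ (c : A) (m : ℕ), p = C c * X ^ m := by
  have hpq : p * q ≠ 0 := by simp [h, ha]
  obtain ⟨hp, hq⟩ := mul_ne_zero_iff.1 hpq
  have hdeg := natDegree_mul hp hq
  have htrail := natTrailingDegree_mul hp hq
  rw [h, natDegree_C_mul_X_pow n a ha] at hdeg
  rw [h, C_mul_X_pow_eq_monomial, natTrailingDegree_monomial ha] at htrail
  have hp' := natTrailingDegree_le_natDegree p
  have hq' := natTrailingDegree_le_natDegree q
  refine ⟨p.coeff p.natDegree, p.natDegree, ext fun i => ?_⟩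
  rw [coeff_C_mul_X_pow]
  split_ifs with hi
  · rw [hi]
  · rcases lt_or_gt_of_ne hi with hlt | hgt
    · exact coeff_eq_zero_of_lt_natTrailingDegree (by omega)
    · exact coeff_eq_zero_of_natDegree_lt hgt

end Polynomial

namespace LaurentPolynomial

open scoped LaurentPolynomial

/-- Over a domain, a divisor of a nonzero constant Laurent polynomial is a monomial. -/
theorem exists_eq_C_mul_T_of_dvd_C {A : Type*} [CommRing A] [IsDomain A] {p : A[T;T⁻¹]} {a : A}
    (ha : a ≠ 0) (h : p ∣ C a) : ∃ (c : A) (n : ℤ), p = C c * T n := by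
  obtain ⟨q, hq⟩ := h
  obtain ⟨n, p', hp'⟩ := exists_T_pow p
  obtain ⟨m, q', hq'⟩ := exists_T_pow q
  have hmul : p' * q' = Polynomial.C a * Polynomial.X ^ (n + m) := by
    apply Polynomial.toLaurent_injective
    rw [map_mul, hp', hq', Polynomial.toLaurent_C_mul_X_pow, hq, Nat.cast_add, T_add]
    ring
  obtain ⟨c, l, hc⟩ := Polynomial.exists_eq_C_mul_X_pow_of_mul_eq ha hmul
  refine ⟨c, l - n, ?_⟩
  rw [hc, Polynomial.toLaurent_C_mul_X_pow] at hp'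
  rw [T_sub, ← mul_assoc, hp', mul_assoc, ← T_add, add_neg_cancel, T_zero, mul_one]

/-- A domain is factorial as soon as its ring of Laurent polynomials is. -/
theorem uniqueFactorizationMonoid_of_laurentPolynomial (A : Type*) [CommRing A] [IsDomain A]
    [UniqueFactorizationMonoid A[T;T⁻¹]] : UniqueFactorizationMonoid A := by
  let ε : A[T;T⁻¹] →+* A := eval₂ (RingHom.id A) 1
  have hε (a : A) : ε (C a) = a := by simp [ε]
  have hC : Function.Injective (C : A →+* A[T;T⁻¹]) := Function.LeftInverse.injective hε
  refine .of_exists_prime_factors fun a ha => ?_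
  obtain ⟨f, hf, hprod⟩ :=
    UniqueFactorizationMonoid.exists_prime_factors (C a) ((map_ne_zero_iff _ hC).2 ha)
  refine ⟨f.map ε, fun b hb => ?_, ?_⟩
  · obtain ⟨p, hp, rfl⟩ := Multiset.mem_map.1 hb
    obtain ⟨c, n, rfl⟩ :=
      exists_eq_C_mul_T_of_dvd_C ha ((Multiset.dvd_prod hp).trans hprod.dvd)
    have hc : Prime (C c : A[T;T⁻¹]) :=
      (associated_mul_unit_left (C c) (T n) (isUnit_T n)).prime (hf _ hp)
    simpa [ε] using comap_prime C ε hε hc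
  · rw [Multiset.prod_hom, ← hε a]
    exact hprod.map ε

end LaurentPolynomial

namespace coordSL

open scoped LaurentPolynomial

/-- The value of the generic determinant at a matrix with its `i₀`-th row scaled by `t`. -/
theorem aeval_genericDet_smul_row {k : ℕ} {S : Type*} [CommRing S] [Algebra ℂ S] (i₀ : Fin k)
    (t : S) (x : Fin k × Fin k → S) :
    aeval (fun p => (if p.1 = i₀ then t else 1) * x p) (genericDet k) =
      t * aeval x (genericDet k) := by
  have key (y : Fin k × Fin k → S) :
      aeval y (genericDet k) = Matrix.det (Matrix.of fun i j => y (i, j)) := by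
    rw [genericDet, AlgHom.map_det]
    congr 1
    ext i j
    simp
  rw [key, key]
  refine (Matrix.det_mul_column (fun i => if i = i₀ then t else 1)
    (Matrix.of fun i j => x (i, j))).trans ?_
  simp

/-- The class in `ℂ[SL_k]` of a matrix entry. -/
noncomputable def entry {k : ℕ} (p : Fin k × Fin k) : coordSL k :=
  Ideal.Quotient.mk _ (X p)

theorem aeval_entry_genericDet (k : ℕ) :
    aeval (entry (k := k)) (genericDet k) = 1 := by
  have h : aeval (entry (k := k)) = Ideal.Quotient.mkₐ ℂ (Ideal.span {genericDet k - 1}) := by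
    ext p
    simp [entry]
  rw [h, ← map_one (Ideal.Quotient.mkₐ ℂ (Ideal.span {genericDet k - 1}))]
  exact Ideal.Quotient.eq.2 (Ideal.mem_span_singleton_self _)

/-- The coordinate ring `ℂ[GL_k]`. -/
abbrev coordGL (k : ℕ) : Type := Localization.Away (genericDet k)

/-- The determinant, as a unit of `ℂ[GL_k]`. -/
noncomputable def detUnit (k : ℕ) : (coordGL k)ˣ :=
  (IsLocalization.Away.algebraMap_isUnit (S := coordGL k) (genericDet k)).unit

theorem val_detUnit (k : ℕ) : (detUnit k : coordGL k) = algebraMap _ _ (genericDet k) := rfl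

/-- Scaling the `i₀`-th row by `T`, as a map `ℂ[X] → ℂ[SL_k][T;T⁻¹]`. -/
noncomputable def scaleRow {k : ℕ} (i₀ : Fin k) :
    MvPolynomial (Fin k × Fin k) ℂ →ₐ[ℂ] (coordSL k)[T;T⁻¹] :=
  aeval fun p => (if p.1 = i₀ then LaurentPolynomial.T 1 else 1) * LaurentPolynomial.C (entry p)

theorem scaleRow_genericDet {k : ℕ} (i₀ : Fin k) :
    scaleRow i₀ (genericDet k) = LaurentPolynomial.T 1 := by
  have h : aeval (fun p => LaurentPolynomial.C (entry (k := k) p)) (genericDet k) =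
      LaurentPolynomial.C (aeval (entry (k := k)) (genericDet k)) :=
    (aeval_algebraMap_apply (coordSL k)[T;T⁻¹] (entry (k := k)) (genericDet k))
  refine (aeval_genericDet_smul_row i₀ _ fun p => LaurentPolynomial.C (entry p)).trans ?_
  rw [h, aeval_entry_genericDet, map_one, mul_one]

/-- Multiplication `SL_k × 𝔾ₘ → GL_k`, `(g, t) ↦ diag(1, …, t, …, 1) g`, on coordinate rings. -/
noncomputable def ofGL {k : ℕ} (i₀ : Fin k) : coordGL k →+* (coordSL k)[T;T⁻¹] :=
  IsLocalization.Away.lift (P := (coordSL k)[T;T⁻¹]) (genericDet k) (g := (scaleRow i₀).toRingHom)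
    ((scaleRow_genericDet i₀).symm ▸ LaurentPolynomial.isUnit_T (R := coordSL k) 1)

/-- Dividing the `i₀`-th row by the determinant, as a map `GL_k → SL_k` on coordinate rings. -/
noncomputable def normalizeRow {k : ℕ} (i₀ : Fin k) : coordSL k →ₐ[ℂ] coordGL k :=
  Ideal.Quotient.liftₐ _
    (aeval fun p => (if p.1 = i₀ then ↑(detUnit k)⁻¹ else 1) *
      algebraMap (MvPolynomial (Fin k × Fin k) ℂ) (coordGL k) (X p)) fun a ha => by
    obtain ⟨b, rfl⟩ := Ideal.mem_span_singleton.1 ha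
    have h : aeval (fun p => algebraMap (MvPolynomial (Fin k × Fin k) ℂ) (coordGL k) (X p))
        (genericDet k) = detUnit k :=
      (aeval_algebraMap_apply (coordGL k) X (genericDet k)).trans <| by
        rw [aeval_X_left_apply, val_detUnit]
    rw [map_mul, map_sub, aeval_genericDet_smul_row, h, Units.inv_mul, map_one, sub_self, zero_mul]

theorem normalizeRow_entry {k : ℕ} (i₀ : Fin k) (p : Fin k × Fin k) :
    normalizeRow i₀ (entry p) = (if p.1 = i₀ then ↑(detUnit k)⁻¹ else 1) *
      algebraMap (MvPolynomial (Fin k × Fin k) ℂ) (coordGL k) (X p) :=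
  (Ideal.Quotient.lift_mk _ _ _).trans (aeval_X _ _)

/-- The inverse of `ofGL`. -/
noncomputable def toGL {k : ℕ} (i₀ : Fin k) : (coordSL k)[T;T⁻¹] →+* coordGL k :=
  LaurentPolynomial.eval₂ (normalizeRow i₀).toRingHom (detUnit k)

theorem ofGL_algebraMap {k : ℕ} (i₀ : Fin k) (p : MvPolynomial (Fin k × Fin k) ℂ) :
    ofGL i₀ (algebraMap _ _ p) = scaleRow i₀ p :=
  IsLocalization.Away.lift_eq (P := (coordSL k)[T;T⁻¹]) (genericDet k) _ p

theorem ofGL_inv_detUnit {k : ℕ} (i₀ : Fin k) :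
    ofGL i₀ ↑(detUnit k)⁻¹ = LaurentPolynomial.T (-1) := by
  have h : LaurentPolynomial.T 1 * ofGL i₀ ↑(detUnit k)⁻¹ = 1 := by
    rw [← scaleRow_genericDet i₀, ← ofGL_algebraMap, ← val_detUnit, ← map_mul, Units.mul_inv,
      map_one]
  apply (LaurentPolynomial.isUnit_T (R := coordSL k) 1).mul_left_cancel
  rw [h, ← LaurentPolynomial.T_add, add_neg_cancel, LaurentPolynomial.T_zero]

theorem toGL_comp_ofGL {k : ℕ} (i₀ : Fin k) : (toGL i₀).comp (ofGL i₀) = RingHom.id _ := by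
  apply IsLocalization.ringHom_ext (Submonoid.powers (genericDet k))
  apply MvPolynomial.ringHom_ext
  · intro r
    have h : scaleRow i₀ (C r) = LaurentPolynomial.C (algebraMap ℂ _ r) :=
      (scaleRow i₀).commutes r
    have h' : algebraMap ℂ (coordGL k) r = algebraMap _ _ (C r : MvPolynomial _ ℂ) :=
      IsScalarTower.algebraMap_apply ℂ (MvPolynomial (Fin k × Fin k) ℂ) (coordGL k) r
    simp [ofGL_algebraMap, h, toGL, h']
  · rintro p
    by_cases hp : p.1 = i₀ <;>
      simp [ofGL_algebraMap, scaleRow, toGL, normalizeRow_entry, hp, mul_right_comm]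

theorem ofGL_comp_toGL {k : ℕ} (i₀ : Fin k) : (ofGL i₀).comp (toGL i₀) = RingHom.id _ := by
  have hC : ((ofGL i₀).comp (normalizeRow i₀).toRingHom) = LaurentPolynomial.C := by
    apply Ideal.Quotient.ringHom_ext
    apply MvPolynomial.ringHom_ext
    · intro r
      have h : scaleRow i₀ (C r) = LaurentPolynomial.C (algebraMap ℂ _ r) :=
        (scaleRow i₀).commutes r
      have h' : normalizeRow i₀ (Ideal.Quotient.mk _ (C r)) =
          algebraMap _ _ (C r : MvPolynomial _ ℂ) :=
        ((normalizeRow i₀).commutes r).trans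
          (IsScalarTower.algebraMap_apply ℂ (MvPolynomial (Fin k × Fin k) ℂ) (coordGL k) r)
      exact (congrArg _ h').trans ((ofGL_algebraMap i₀ _).trans h)
    · intro p
      refine (congrArg (ofGL i₀) (normalizeRow_entry i₀ p)).trans ?_
      rw [map_mul, ofGL_algebraMap, scaleRow, aeval_X]
      split_ifs
      · rw [ofGL_inv_detUnit, ← mul_assoc, ← LaurentPolynomial.T_add]
        simp [entry]
      · simp [entry]
  refine IsLocalization.ringHom_ext (S := (coordSL k)[T;T⁻¹])
    (Submonoid.powers (Polynomial.X : Polynomial (coordSL k))) ?_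
  apply Polynomial.ringHom_ext
  · intro a
    simpa [toGL] using RingHom.congr_fun hC a
  · simp [toGL, val_detUnit, ofGL_algebraMap, scaleRow_genericDet]

/-- `ℂ[GL_k] ≃ ℂ[SL_k][T;T⁻¹]`. -/
noncomputable def equivGL {k : ℕ} (i₀ : Fin k) : coordGL k ≃+* (coordSL k)[T;T⁻¹] :=
  RingEquiv.ofRingHom (ofGL i₀) (toGL i₀) (ofGL_comp_toGL i₀) (toGL_comp_ofGL i₀)

end coordSL

/-- The coordinate ring `ℂ[SL_k]` is factorial (case `G = SL_k` of Proposition 6.4.8):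
it is an integral domain, and it is a unique factorization domain. -/
theorem coordSL_ufd (k : ℕ) (hk : 2 ≤ k) :
    IsDomain (coordSL k) ∧ ∀ [IsDomain (coordSL k)], UniqueFactorizationMonoid (coordSL k) := by
  let i₀ : Fin k := ⟨0, by omega⟩
  have hdet : genericDet k ≠ 0 := Matrix.det_mvPolynomialX_ne_zero (Fin k) ℂ
  have hGL : IsDomain (coordSL.coordGL k) :=
    IsLocalization.isDomain_localization (powers_le_nonZeroDivisors_of_noZeroDivisors hdet)
  have hLaurent : IsDomain (LaurentPolynomial (coordSL k)) :=
    (coordSL.equivGL i₀).symm.toMulEquiv.isDomain _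
  have hC : Function.Injective (LaurentPolynomial.C : coordSL k →+* _) :=
    fun a b h => by simpa using congrArg (fun f => f.coeff 0) h
  refine ⟨hC.isDomain _, ?_⟩
  intro _
  have : UniqueFactorizationMonoid (LaurentPolynomial (coordSL k)) :=
    (coordSL.equivGL i₀).toMulEquiv.uniqueFactorizationMonoid inferInstance
  exact LaurentPolynomial.uniqueFactorizationMonoid_of_laurentPolynomial _
end

section
/- Let m ≥ 4. Consider the ℂ-algebra homomorphism φ from the polynomial ring ℂ[x_{ij} : 1 ≤ i < j ≤ m] to the polynomial ring in the entries of a 2×m matrix of indeterminates z, defined by φ(x_{ij}) = P_{ij} = z_{1i}z_{2j} − z_{1j}z_{2i}. Then the kernel of φ is the ideal generated by the three-term Grassmann–Plücker polynomials x_{ik}x_{jl} − x_{ij}x_{kl} − x_{il}x_{jk} for all 1 ≤ i < j < k < l ≤ m. -/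
open MvPolynomial

/-- Variable indices for the formal Plücker variables `x_{ij}`, `1 ≤ i < j ≤ m`. -/
abbrev PairIdx (m : ℕ) : Type := { p : ℕ × ℕ // 1 ≤ p.1 ∧ p.1 < p.2 ∧ p.2 ≤ m }

/-- The `ℂ`-algebra homomorphism `φ` sending the formal variable `x_{ij}` to the
Plücker coordinate `P_{ij}`. -/
noncomputable def pluckerHom (m : ℕ) :
    MvPolynomial (PairIdx m) ℂ →ₐ[ℂ] MvPolynomial (ℕ × ℕ) ℂ :=
  aeval (fun p => P2 p.1.1 p.1.2)

section LowerTerms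

variable {σ R : Type*} [CommRing R]

/-- A polynomial all of whose exponents other than `d` have `w`-weight smaller than that of `d`,
and whose coefficient at `d` is `1`, expressed through the difference with the leading monomial. -/
def HasLeadingExponent (w : σ → ℕ) (p : MvPolynomial σ R) (d : σ →₀ ℕ) : Prop :=
  ∀ e ∈ (p - monomial d 1).support, Finsupp.weight w e < Finsupp.weight w d

theorem HasLeadingExponent.mul {w : σ → ℕ} {p q : MvPolynomial σ R} {d e : σ →₀ ℕ}
    (hp : HasLeadingExponent w p d) (hq : HasLeadingExponent w q e) :
    HasLeadingExponent w (p * q) (d + e) := by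
  classical
  intro c hc
  have key : p * q - monomial (d + e) 1 =
      monomial d 1 * (q - monomial e 1) + (p - monomial d 1) * monomial e 1
        + (p - monomial d 1) * (q - monomial e 1) := by
    have : (monomial (d + e) 1 : MvPolynomial σ R) = monomial d 1 * monomial e 1 := by
      simp [monomial_mul]
    rw [this]
    ring
  rw [key] at hc
  rw [map_add]
  rcases Finset.mem_union.1 (support_add hc) with h | h
  · rcases Finset.mem_union.1 (support_add h) with h | h
    · obtain ⟨a, ha, b, hb, rfl⟩ := Finset.mem_add.1 (support_mul _ _ h)
      obtain rfl : a = d := by simpa using support_monomial_subset ha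
      rw [map_add]
      exact Nat.add_lt_add_left (hq b hb) _
    · obtain ⟨a, ha, b, hb, rfl⟩ := Finset.mem_add.1 (support_mul _ _ h)
      obtain rfl : b = e := by simpa using support_monomial_subset hb
      rw [map_add]
      exact Nat.add_lt_add_right (hp a ha) _
  · obtain ⟨a, ha, b, hb, rfl⟩ := Finset.mem_add.1 (support_mul _ _ h)
    rw [map_add]
    exact Nat.add_lt_add (hp a ha) (hq b hb)

theorem HasLeadingExponent.coeff_eq {w : σ → ℕ} {p : MvPolynomial σ R} {d e : σ →₀ ℕ}
    (hp : HasLeadingExponent w p d) (h : Finsupp.weight w d ≤ Finsupp.weight w e) :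
    coeff e p = coeff e (monomial d (1 : R)) := by
  by_contra hne
  have : e ∈ (p - monomial d 1).support := by
    rw [mem_support_iff, coeff_sub]
    exact sub_ne_zero.2 hne
  exact absurd (hp e this) (not_lt.2 h)

end LowerTerms

theorem Finsupp.weight_weight {α β : Type*} (v : α → β →₀ ℕ) (w : β → ℕ) (s : α →₀ ℕ) :
    Finsupp.weight w (Finsupp.weight v s) = Finsupp.weight (fun a => Finsupp.weight w (v a)) s := by
  induction s using Finsupp.induction_linear with
  | zero => simp
  | add f g hf hg => simp [hf, hg]
  | single a n => simp [Finsupp.weight_single]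

/-- The exponent of the leading monomial `z_{1i} z_{2j}` of `P_{ij}`, extended additively. -/
noncomputable def leadExp {m : ℕ} (s : PairIdx m →₀ ℕ) : ℕ × ℕ →₀ ℕ :=
  Finsupp.weight (fun p : PairIdx m =>
    Finsupp.single (1, p.1.1) 1 + Finsupp.single (2, p.1.2) 1) s

/-- The weight on matrix entries selecting `z_{1i} z_{2j}` as the leading term of `P_{ij}`. -/
def entryWeight (c : ℕ × ℕ) : ℕ := if c.1 = 2 then c.2 else 0

theorem hasLeadingExponent_P2 {i j : ℕ} (h : i < j) :
    HasLeadingExponent entryWeight (P2 i j)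
      (Finsupp.single (1, i) 1 + Finsupp.single (2, j) 1) := by
  intro e he
  have key : P2 i j - monomial (Finsupp.single (1, i) 1 + Finsupp.single (2, j) 1) 1
      = monomial (Finsupp.single (1, j) 1 + Finsupp.single (2, i) 1) (-1) := by
    simp [P2, X, monomial_mul]
  rw [key] at he
  obtain rfl := Finset.mem_singleton.1 (support_monomial_subset he)
  simpa [Finsupp.weight_single, entryWeight] using h

theorem hasLeadingExponent_pluckerHom {m : ℕ} (s : PairIdx m →₀ ℕ) :
    HasLeadingExponent entryWeight (pluckerHom m (monomial s 1)) (leadExp s) := by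
  induction s using Finsupp.induction_linear with
  | zero => intro e he; simp [leadExp] at he
  | add s t hs ht =>
    have h := hs.mul ht
    rw [← map_mul, monomial_mul, one_mul] at h
    simpa only [leadExp, map_add] using h
  | single p n =>
    induction n with
    | zero => intro e he; simp [leadExp] at he
    | succ n ih =>
      have h := ih.mul (hasLeadingExponent_P2 p.2.2.1)
      have hX : P2 p.1.1 p.1.2 = pluckerHom m (monomial (Finsupp.single p 1) 1) := by
        rw [← X, pluckerHom, aeval_X]
      rw [hX, ← map_mul, monomial_mul, one_mul, ← Finsupp.single_add] at h
      simpa only [leadExp, Finsupp.weight_single, add_smul, one_smul] using h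

/-- Exponents of standard monomials: no two index pairs are strictly nested. -/
def IsNonnesting {m : ℕ} (s : PairIdx m →₀ ℕ) : Prop :=
  ∀ p ∈ s.support, ∀ q ∈ s.support, ¬ (p.1.1 < q.1.1 ∧ q.1.2 < p.1.2)

/-- The number of index pairs, with multiplicity, whose entries lie below given thresholds. -/
noncomputable def countBelow {m : ℕ} (a b : ℕ) (s : PairIdx m →₀ ℕ) : ℕ :=
  Finsupp.weight (fun p : PairIdx m => if p.1.1 < a ∧ p.1.2 < b then 1 else 0) s

theorem IsNonnesting.countBelow_eq {m : ℕ} {s : PairIdx m →₀ ℕ} (hs : IsNonnesting s) (a b : ℕ) :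
    countBelow a b s =
      min (Finsupp.weight (fun c : ℕ × ℕ => if c.1 = 1 ∧ c.2 < a then 1 else 0) (leadExp s))
        (Finsupp.weight (fun c : ℕ × ℕ => if c.1 = 2 ∧ c.2 < b then 1 else 0) (leadExp s)) := by
  simp only [leadExp, Finsupp.weight_weight, countBelow]
  simp only [map_add, Finsupp.weight_apply, Finsupp.sum]
  by_cases h : ∃ p ∈ s.support, p.1.1 < a ∧ ¬ p.1.2 < b
  · obtain ⟨p, hp, hpa, hpb⟩ := h
    rw [min_eq_right]
    · refine Finset.sum_congr rfl fun q hq => ?_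
      have := hs p hp q hq
      congr 1
      simp
      grind
    · refine Finset.sum_le_sum fun q hq => ?_
      have := hs p hp q hq
      refine smul_le_smul_of_nonneg_left ?_ (Nat.zero_le _)
      simp
      grind
  · push Not at h
    rw [min_eq_left]
    · refine Finset.sum_congr rfl fun q hq => ?_
      have := h q hq
      congr 1
      simp
      grind
    · refine Finset.sum_le_sum fun q hq => ?_
      have := h q hq
      refine smul_le_smul_of_nonneg_left ?_ (Nat.zero_le _)
      simp
      grind

theorem apply_add_countBelow {m : ℕ} (s : PairIdx m →₀ ℕ) (p : PairIdx m) :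
    s p + countBelow p.1.1 (p.1.2 + 1) s + countBelow (p.1.1 + 1) p.1.2 s =
      countBelow (p.1.1 + 1) (p.1.2 + 1) s + countBelow p.1.1 p.1.2 s := by
  induction s using Finsupp.induction_linear with
  | zero => simp [countBelow]
  | add f g hf hg => simp only [countBelow, map_add, Finsupp.add_apply] at *; omega
  | single q n =>
    simp only [countBelow, Finsupp.weight_single, Finsupp.single_apply, Subtype.ext_iff,
      Prod.ext_iff, smul_eq_mul]
    split_ifs <;> omega

theorem IsNonnesting.eq_of_leadExp_eq {m : ℕ} {s t : PairIdx m →₀ ℕ} (hs : IsNonnesting s)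
    (ht : IsNonnesting t) (h : leadExp s = leadExp t) : s = t := by
  ext p
  have h1 := apply_add_countBelow s p
  have h2 := apply_add_countBelow t p
  simp only [hs.countBelow_eq, h, ← ht.countBelow_eq] at h1
  omega

theorem eq_zero_of_isNonnesting_of_pluckerHom_eq_zero {m : ℕ} {f : MvPolynomial (PairIdx m) ℂ}
    (hf : ∀ s ∈ f.support, IsNonnesting s) (h : pluckerHom m f = 0) : f = 0 := by
  by_contra hne
  obtain ⟨s, hs, hmax⟩ := f.support.exists_max_image
    (fun s => Finsupp.weight entryWeight (leadExp s)) (support_nonempty.2 hne)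
  have hsum : pluckerHom m f =
      ∑ t ∈ f.support, coeff t f • pluckerHom m (monomial t 1) := by
    conv_lhs => rw [f.as_sum, map_sum]
    refine Finset.sum_congr rfl fun t _ => ?_
    rw [← map_smul, smul_monomial, smul_eq_mul, mul_one]
  have hc : coeff (leadExp s) (pluckerHom m f) = coeff s f := by
    rw [hsum, coeff_sum, Finset.sum_eq_single_of_mem s hs]
    · rw [coeff_smul, (hasLeadingExponent_pluckerHom s).coeff_eq le_rfl]
      simp
    · intro t ht hts
      rw [coeff_smul, (hasLeadingExponent_pluckerHom t).coeff_eq (hmax t ht), coeff_monomial,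
        if_neg fun hl => hts ((hf t ht).eq_of_leadExp_eq (hf s hs) hl), smul_zero]
  rw [h, coeff_zero] at hc
  exact mem_support_iff.1 hs hc.symm

/-- The ideal of three-term Grassmann–Plücker relations. -/
noncomputable def threeTermIdeal (m : ℕ) : Ideal (MvPolynomial (PairIdx m) ℂ) :=
  Ideal.span
    { q | ∃ (i j k l : ℕ) (hik : 1 ≤ i ∧ i < k ∧ k ≤ m) (hjl : 1 ≤ j ∧ j < l ∧ l ≤ m)
        (hij : 1 ≤ i ∧ i < j ∧ j ≤ m) (hkl : 1 ≤ k ∧ k < l ∧ l ≤ m)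
        (hil : 1 ≤ i ∧ i < l ∧ l ≤ m) (hjk : 1 ≤ j ∧ j < k ∧ k ≤ m),
        q = X ⟨(i, k), hik⟩ * X ⟨(j, l), hjl⟩ - X ⟨(i, j), hij⟩ * X ⟨(k, l), hkl⟩
          - X ⟨(i, l), hil⟩ * X ⟨(j, k), hjk⟩ }

theorem threeTermIdeal_le_ker (m : ℕ) : threeTermIdeal m ≤ RingHom.ker (pluckerHom m) := by
  refine Ideal.span_le.2 ?_
  rintro _ ⟨i, j, k, l, _, _, _, _, _, _, rfl⟩
  simp only [SetLike.mem_coe, RingHom.mem_ker, map_sub, map_mul, pluckerHom, aeval_X, P2]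
  ring

/-- The total squared length of the index pairs, which decreases under straightening. -/
noncomputable def sqLength {m : ℕ} (s : PairIdx m →₀ ℕ) : ℕ :=
  Finsupp.weight (fun p : PairIdx m => (p.1.2 - p.1.1) ^ 2) s

theorem crossing_sq_lt {i j k l : ℕ} (hij : i < j) (hjk : j < k) (hkl : k < l) :
    (k - i) ^ 2 + (l - j) ^ 2 < (l - i) ^ 2 + (k - j) ^ 2 := by
  obtain ⟨a, rfl⟩ := Nat.exists_eq_add_of_lt hij
  obtain ⟨b, rfl⟩ := Nat.exists_eq_add_of_lt hjk
  obtain ⟨c, rfl⟩ := Nat.exists_eq_add_of_lt hkl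
  simp only [add_assoc, Nat.add_sub_cancel_left, Nat.add_sub_add_left]
  nlinarith [Nat.zero_le (a * b), Nat.zero_le (a * c), Nat.zero_le (b * c)]

theorem disjoint_sq_lt {i j k l : ℕ} (hij : i < j) (hjk : j < k) (hkl : k < l) :
    (j - i) ^ 2 + (l - k) ^ 2 < (l - i) ^ 2 + (k - j) ^ 2 := by
  obtain ⟨a, rfl⟩ := Nat.exists_eq_add_of_lt hij
  obtain ⟨b, rfl⟩ := Nat.exists_eq_add_of_lt hjk
  obtain ⟨c, rfl⟩ := Nat.exists_eq_add_of_lt hkl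
  simp only [add_assoc, Nat.add_sub_cancel_left, Nat.add_sub_add_left]
  nlinarith [Nat.zero_le (a * b), Nat.zero_le (a * c), Nat.zero_le (b * c)]

theorem exists_eq_single_add_single_add {α : Type*} {s : α →₀ ℕ} {p q : α} (hpq : p ≠ q)
    (hp : p ∈ s.support) (hq : q ∈ s.support) :
    ∃ r, s = Finsupp.single p 1 + Finsupp.single q 1 + r := by
  classical
  refine exists_add_of_le fun a => ?_
  rw [Finsupp.mem_support_iff] at hp hq
  simp only [Finsupp.add_apply, Finsupp.single_apply]
  grind

theorem monomial_mem_threeTermIdeal_sup {m : ℕ} (s : PairIdx m →₀ ℕ) :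
    monomial s 1 ∈ (threeTermIdeal m).restrictScalars ℂ ⊔
      restrictSupport ℂ {t : PairIdx m →₀ ℕ | IsNonnesting t} := by
  induction hn : sqLength s using Nat.strong_induction_on generalizing s with
  | _ n ih =>
  subst hn
  by_cases hs : IsNonnesting s
  · refine Submodule.mem_sup_right fun t ht => ?_
    obtain rfl := Finset.mem_singleton.1 (support_monomial_subset ht)
    exact hs
  · simp only [IsNonnesting] at hs
    push Not at hs
    obtain ⟨⟨⟨i, l⟩, hil⟩, hp, ⟨⟨j, k⟩, hjk⟩, hq, h1, h2⟩ := hs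
    dsimp only at hil hjk h1 h2
    obtain ⟨r, rfl⟩ := exists_eq_single_add_single_add (by grind) hp hq
    have hik : 1 ≤ i ∧ i < k ∧ k ≤ m := by omega
    have hjl : 1 ≤ j ∧ j < l ∧ l ≤ m := by omega
    have hij : 1 ≤ i ∧ i < j ∧ j ≤ m := by omega
    have hkl : 1 ≤ k ∧ k < l ∧ l ≤ m := by omega
    have hgen : (X ⟨(i, k), hik⟩ * X ⟨(j, l), hjl⟩ - X ⟨(i, j), hij⟩ * X ⟨(k, l), hkl⟩
        - X ⟨(i, l), hil⟩ * X ⟨(j, k), hjk⟩ : MvPolynomial (PairIdx m) ℂ) ∈ threeTermIdeal m :=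
      Ideal.subset_span ⟨i, j, k, l, hik, hjl, hij, hkl, hil, hjk, rfl⟩
    have hmon (p q : PairIdx m) : (monomial (Finsupp.single p 1 + Finsupp.single q 1 + r) 1 :
        MvPolynomial (PairIdx m) ℂ) = X p * X q * monomial r 1 := by
      simp [X, monomial_mul]
    have hcross := ih _ (by
      simpa [sqLength, Finsupp.weight_single] using crossing_sq_lt h1 hjk.2.1 h2)
      (Finsupp.single ⟨(i, k), hik⟩ 1 + Finsupp.single ⟨(j, l), hjl⟩ 1 + r) rfl
    have hdisj := ih _ (by
      simpa [sqLength, Finsupp.weight_single] using disjoint_sq_lt h1 hjk.2.1 h2)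
      (Finsupp.single ⟨(i, j), hij⟩ 1 + Finsupp.single ⟨(k, l), hkl⟩ 1 + r) rfl
    have hrel := Submodule.mem_sup_left
      (T := restrictSupport ℂ {t : PairIdx m →₀ ℕ | IsNonnesting t})
      ((Submodule.restrictScalars_mem ℂ (threeTermIdeal m) _).2
        (Ideal.mul_mem_right (monomial r 1) _ hgen))
    have := sub_mem (sub_mem hcross hdisj) hrel
    convert this using 1
    simp only [hmon]
    ring

theorem threeTermIdeal_sup_eq_top (m : ℕ) :
    (threeTermIdeal m).restrictScalars ℂ ⊔
      restrictSupport ℂ {t : PairIdx m →₀ ℕ | IsNonnesting t} = ⊤ := by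
  refine eq_top_iff.2 fun f _ => ?_
  rw [f.as_sum]
  refine sum_mem fun s _ => ?_
  rw [← mul_one (coeff s f), ← smul_eq_mul, ← smul_monomial]
  exact Submodule.smul_mem _ _ (monomial_mem_threeTermIdeal_sup s)

theorem ker_pluckerHom_eq_threeTermIdeal (m : ℕ) :
    RingHom.ker (pluckerHom m) = threeTermIdeal m := by
  refine le_antisymm (fun f hf => ?_) (threeTermIdeal_le_ker m)
  have htop : f ∈ (⊤ : Submodule ℂ (MvPolynomial (PairIdx m) ℂ)) := Submodule.mem_top
  rw [← threeTermIdeal_sup_eq_top m] at htop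
  obtain ⟨g, hg, h, hh, rfl⟩ := Submodule.mem_sup.1 htop
  have hg' : pluckerHom m g = 0 := threeTermIdeal_le_ker m hg
  rw [RingHom.mem_ker, map_add, hg', zero_add] at hf
  have h0 : h = 0 := eq_zero_of_isNonnesting_of_pluckerHom_eq_zero (fun s hs => hh hs) hf
  rw [h0, add_zero]
  exact hg

/-- Example 6.3.1: the kernel of `φ : x_{ij} ↦ P_{ij}` is the ideal generated by the
three-term Grassmann–Plücker polynomials
`x_{ik}x_{jl} − x_{ij}x_{kl} − x_{il}x_{jk}`, `1 ≤ i < j < k < l ≤ m`. -/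
theorem plucker_kernel (m : ℕ) (hm : 4 ≤ m) :
    RingHom.ker (pluckerHom m) = Ideal.span
      { q : MvPolynomial (PairIdx m) ℂ |
        ∃ (i j k l : ℕ) (h1 : 1 ≤ i) (h2 : i < j) (h3 : j < k) (h4 : k < l) (h5 : l ≤ m),
          q = X ⟨(i, k), by omega⟩ * X ⟨(j, l), by omega⟩
              - X ⟨(i, j), by omega⟩ * X ⟨(k, l), by omega⟩
              - X ⟨(i, l), by omega⟩ * X ⟨(j, k), by omega⟩ } := by
  rw [ker_pluckerHom_eq_threeTermIdeal, threeTermIdeal]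
  congr 1
  ext q
  constructor
  · rintro ⟨i, j, k, l, -, -, hij, hkl, -, hjk, rfl⟩
    exact ⟨i, j, k, l, hij.1, hij.2.1, hjk.2.1, hkl.2.1, hkl.2.2, rfl⟩
  · rintro ⟨i, j, k, l, _, _, _, _, _, rfl⟩
    exact ⟨i, j, k, l, _, _, _, _, _, _, rfl⟩
end

section
/- In the field ℂ(z₁, z₂) of rational functions in two variables, define z₃ = (z₂² + 1)/z₁, z₄ = (z₃ + 1)/z₂, z₅ = (z₄² + 1)/z₃, z₆ = (z₅ + 1)/z₄ (all denominators are nonzero elements of the field). Then: (i) z₅·z₁ = z₆² + 1 and z₆·z₂ = z₁ + 1 (so the sequence defined by the type B₂ exchange recurrence is 6-periodic); and (ii) the additional relations z₁·z₄ = z₂ + z₆, z₃·z₆ = z₄ + z₂, and z₅·z₂ = z₆ + z₄ hold. -/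
open MvPolynomial

/-- The type `B₂` exchange recurrence over a field: as soon as the denominators do not vanish, it is
6-periodic and satisfies the three additional relations. -/
theorem typeB2_relations_of_ne_zero {K : Type*} [Field K] {a b z₃ z₄ z₅ z₆ : K}
    (ha : a ≠ 0) (hb : b ≠ 0) (hb' : b ^ 2 + 1 ≠ 0) (hab : a + b ^ 2 + 1 ≠ 0)
    (hz₃ : z₃ = (b ^ 2 + 1) / a) (hz₄ : z₄ = (z₃ + 1) / b)
    (hz₅ : z₅ = (z₄ ^ 2 + 1) / z₃) (hz₆ : z₆ = (z₅ + 1) / z₄) :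
    (a ≠ 0 ∧ b ≠ 0 ∧ z₃ ≠ 0 ∧ z₄ ≠ 0) ∧
    (z₅ * a = z₆ ^ 2 + 1 ∧ z₆ * b = a + 1) ∧
    (a * z₄ = b + z₆ ∧ z₃ * z₆ = z₄ + b ∧ z₅ * b = z₆ + z₄) := by
  have h₃ : z₃ ≠ 0 := hz₃ ▸ div_ne_zero hb' ha
  have e₄ : z₄ = (a + b ^ 2 + 1) / (a * b) := by
    rw [hz₄, hz₃]
    field_simp
    ring
  have h₄ : z₄ ≠ 0 := e₄ ▸ div_ne_zero hab (mul_ne_zero ha hb)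
  have e₅ : z₅ = ((a + 1) ^ 2 + b ^ 2) / (a * b ^ 2) := by
    rw [hz₅, div_eq_iff h₃, e₄, hz₃]
    field_simp
    ring
  have e₆ : z₆ = (a + 1) / b := by
    rw [hz₆, div_eq_iff h₄, e₅, e₄]
    field_simp
    ring
  refine ⟨⟨ha, hb, h₃, h₄⟩, ⟨?_, ?_⟩, ?_, ?_, ?_⟩
  · rw [e₅, e₆]
    field_simp
  · rw [e₆]
    field_simp
  · rw [e₄, e₆]
    field_simp
    ring
  · rw [hz₃, e₄, e₆]
    field_simp
    ring
  · rw [e₅, e₄, e₆]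
    field_simp
    ring

/-- Example 6.8.3, part one: in the field `ℂ(z₁, z₂)` of rational functions in two
variables, with `z₃ = (z₂² + 1)/z₁`, `z₄ = (z₃ + 1)/z₂`, `z₅ = (z₄² + 1)/z₃`,
`z₆ = (z₅ + 1)/z₄` (all denominators nonzero), the type `B₂` exchange recurrence is
6-periodic: `z₅·z₁ = z₆² + 1` and `z₆·z₂ = z₁ + 1`; moreover the additional relations
`z₁·z₄ = z₂ + z₆`, `z₃·z₆ = z₄ + z₂`, and `z₅·z₂ = z₆ + z₄` hold. -/
theorem typeB2_relations
    (z₁ z₂ z₃ z₄ z₅ z₆ : FractionRing (MvPolynomial (Fin 2) ℂ))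
    (hz₁ : z₁ = algebraMap (MvPolynomial (Fin 2) ℂ) _ (X 0))
    (hz₂ : z₂ = algebraMap (MvPolynomial (Fin 2) ℂ) _ (X 1))
    (hz₃ : z₃ = (z₂ ^ 2 + 1) / z₁)
    (hz₄ : z₄ = (z₃ + 1) / z₂)
    (hz₅ : z₅ = (z₄ ^ 2 + 1) / z₃)
    (hz₆ : z₆ = (z₅ + 1) / z₄) :
    (z₁ ≠ 0 ∧ z₂ ≠ 0 ∧ z₃ ≠ 0 ∧ z₄ ≠ 0) ∧
    (z₅ * z₁ = z₆ ^ 2 + 1 ∧ z₆ * z₂ = z₁ + 1) ∧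
    (z₁ * z₄ = z₂ + z₆ ∧ z₃ * z₆ = z₄ + z₂ ∧ z₅ * z₂ = z₆ + z₄) := by
  have hne {p : MvPolynomial (Fin 2) ℂ} (hp : p ≠ 0) :
      algebraMap (MvPolynomial (Fin 2) ℂ) (FractionRing (MvPolynomial (Fin 2) ℂ)) p ≠ 0 :=
    (map_ne_zero_iff _ (IsFractionRing.injective _ _)).2 hp
  have hp : (X 1 ^ 2 + 1 : MvPolynomial (Fin 2) ℂ) ≠ 0 := fun h => by
    simpa using congrArg (eval 0) h
  have hq : (X 0 + X 1 ^ 2 + 1 : MvPolynomial (Fin 2) ℂ) ≠ 0 := fun h => by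
    simpa using congrArg (eval 0) h
  refine typeB2_relations_of_ne_zero ?_ ?_ ?_ ?_ hz₃ hz₄ hz₅ hz₆
  · exact hz₁ ▸ hne (X_ne_zero 0)
  · exact hz₂ ▸ hne (X_ne_zero 1)
  · simpa [hz₂] using hne hp
  · simpa [hz₁, hz₂] using hne hq
end

section
/- In the polynomial ring ℂ[z₁, z₂, z₃, z₄, z₅, z₆], the polynomial z₁z₄ − z₂ − z₆ does not belong to the ideal generated by the six polynomials z₁z₃ − z₂² − 1, z₂z₄ − z₃ − 1, z₃z₅ − z₄² − 1, z₄z₆ − z₅ − 1, z₅z₁ − z₆² − 1, and z₆z₂ − z₁ − 1. -/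
open MvPolynomial

/-- The relations vanish at `z₂ = ε`, `z₄ = z₆ = 0`, `z₁ = z₃ = z₅ = -1` in the dual numbers,
while `z₁z₄ − z₂ − z₆` takes the value `-ε ≠ 0`. -/
noncomputable def dualNumberEval : MvPolynomial (Fin 6) ℂ →ₐ[ℂ] DualNumber ℂ :=
  aeval ![-1, DualNumber.eps, -1, 0, -1, 0]

/-- Example 6.8.3, part two: in the polynomial ring `ℂ[z₁,…,z₆]` (variables `X 0,…,X 5`
standing for `z₁,…,z₆`), the polynomial `z₁z₄ − z₂ − z₆` does not belong to the ideal
generated by the six type `B₂` exchange relations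
`z₁z₃ − z₂² − 1`, `z₂z₄ − z₃ − 1`, `z₃z₅ − z₄² − 1`, `z₄z₆ − z₅ − 1`, `z₅z₁ − z₆² − 1`,
`z₆z₂ − z₁ − 1`. -/
theorem typeB2_not_in_exchange_ideal :
    (X 0 * X 3 - X 1 - X 5 : MvPolynomial (Fin 6) ℂ) ∉
      Ideal.span {X 0 * X 2 - (X 1) ^ 2 - 1,
                  X 1 * X 3 - X 2 - 1,
                  X 2 * X 4 - (X 3) ^ 2 - 1,
                  X 3 * X 5 - X 4 - 1,
                  X 4 * X 0 - (X 5) ^ 2 - 1,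
                  X 5 * X 1 - X 0 - 1} := by
  intro hmem
  have hker := (Ideal.span_le (I := RingHom.ker dualNumberEval)).2 (by
    rintro p (rfl | rfl | rfl | rfl | rfl | rfl) <;>
      simp [RingHom.mem_ker, dualNumberEval, pow_two]) hmem
  have hzero := congrArg TrivSqZeroExt.snd (RingHom.mem_ker.1 hker)
  simp [dualNumberEval] at hzero
end
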